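/- arXiv:2207.02772 — 3 statements merged into one kernel-verified Lean document; each statement's English description precedes it below -/
import Mathlib

section
/- For every integer k ≥ 3 there exist constants c > 0 and γ > 0 such that for all sufficiently large n and every integer b with 1 ≤ b ≤ c·n^{2/k}, in the b-Waiter-Client game played on the board {1, 2, …, n}, Waiter can ensure that Client's final set S contains at least γ·n²/b^k k-term arithmetic progressions. -/
/-!
Common definitions:
* A formal model of the `b`-Waiter-Client game on a finite board.
* Complete `H`-partite graphs `K_n^H`, canonical copies of induced subgraphs,
  canonical copies of the overlap graphs `H^J`, and the associated counting functions.
-/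

namespace WCGame

variable {X : Type*} [DecidableEq X]

/-- A history of play: the list of rounds so far, each round consisting of the
set of elements offered by Waiter together with the element chosen by Client. -/
abbrev Hist (X : Type*) := List (Finset X × X)

/-- All elements offered so far during a history. -/
def offeredSet (h : Hist X) : Finset X := h.foldr (fun r acc => r.1 ∪ acc) ∅

/-- A Waiter strategy: to every history it assigns either a set of elements to
offer next, or `none`, meaning that Waiter declares the game over. -/
abbrev WaiterStrategy (X : Type*) := Hist X → Option (Finset X)

/-- A Client strategy: to every history and currently offered set it assigns
the element of that set that Client picks. -/
abbrev ClientStrategy (X : Type*) := Hist X → Finset X → X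

/-- A Waiter strategy is legal (for board `board` and parameter `b`) if every
set it offers consists of exactly `b` elements of the board which were not
offered in any previous round.  (Waiter may always stop instead, in particular
when fewer than `b` unoffered elements remain no legal offer exists and a legal
Waiter strategy must stop.) -/
def WaiterLegal (board : Finset X) (b : ℕ) (W : WaiterStrategy X) : Prop :=
  ∀ h O, W h = some O → O.card = b ∧ O ⊆ board ∧ Disjoint O (offeredSet h)

/-- A Client strategy is legal if it always picks an element of the offered set. -/
def ClientLegal (C : ClientStrategy X) : Prop :=
  ∀ h O, O.Nonempty → C h O ∈ O

/-- Playing the game for at most `fuel` further rounds from a given history. -/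
def playAux (W : WaiterStrategy X) (C : ClientStrategy X) : ℕ → Hist X → Hist X
  | 0, h => h
  | fuel + 1, h =>
    match W h with
    | none => h
    | some O => playAux W C fuel (h ++ [(O, C h O)])

/-- Client's final set `S`: the set of all elements chosen by Client during the
whole game.  (For a legal Waiter strategy with `b ≥ 1` the game lasts at most
`board.card` rounds, so the fuel `board.card` never truncates the game.) -/
def finalSet (board : Finset X) (W : WaiterStrategy X) (C : ClientStrategy X) : Finset X :=
  ((playAux W C board.card []).map Prod.snd).toFinset

/-- Waiter can ensure that Client's final set has property `P` in the
`b`-Waiter-Client game on `board`. -/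
def WaiterCanEnsure (board : Finset X) (b : ℕ) (P : Finset X → Prop) : Prop :=
  ∃ W : WaiterStrategy X, WaiterLegal board b W ∧
    ∀ C : ClientStrategy X, ClientLegal C → P (finalSet board W C)

end WCGame

namespace GraphDefs

variable {α : Type*} [Fintype α] [DecidableEq α]

/-- The maximum density `m(H) = max { e(H')/v(H') : H' ⊆ H, v(H') ≥ 1 }`. -/
noncomputable def maxDensity (H : SimpleGraph α) : ℝ :=
  sSup { d : ℝ | ∃ H' : H.Subgraph, H'.verts.Nonempty ∧
          d = (H'.edgeSet.ncard : ℝ) / (H'.verts.ncard : ℝ) }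

/-- The complete `H`-partite graph `K_n^H`: the part `V_a` corresponding to a
vertex `a` of `H` is `{a} × Fin n`, and `(a,i)` is adjacent to `(b,j)` iff
`a` and `b` are adjacent in `H`. -/
def Kpart (H : SimpleGraph α) (n : ℕ) : SimpleGraph (α × Fin n) :=
  SimpleGraph.comap Prod.fst H

/-- Number of edges of the induced subgraph `H[s]`, i.e. edges of `H` with both
endpoints in `s`. -/
noncomputable def eIn (H : SimpleGraph α) (s : Set α) : ℕ :=
  {e ∈ H.edgeSet | ∀ v ∈ e, v ∈ s}.ncard

/-- Canonical copies of the induced subgraph `H[s]` in `G ⊆ K_n^H`.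
A canonical copy is an (automatically injective) edge-preserving map
`a ↦ (a, f a)` sending each vertex `a ∈ s` into its part `V_a`; it is thus
faithfully encoded by the function `f : s → Fin n` of second coordinates. -/
def canonCopies (H : SimpleGraph α) (n : ℕ) (G : SimpleGraph (α × Fin n)) (s : Set α) :
    Set (s → Fin n) :=
  { f | ∀ a b : s, H.Adj a b → G.Adj ((a : α), f a) ((b : α), f b) }

/-- `N_G(H[s])`: the number of canonical copies of the induced subgraph `H[s]` in `G`. -/
noncomputable def NCopies (H : SimpleGraph α) (n : ℕ) (G : SimpleGraph (α × Fin n))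
    (s : Set α) : ℕ :=
  (canonCopies H n G s).ncard

/-- The canonical copy encoded by `f` contains the vertex `(x, u)` of `K_n^H`. -/
def containsVtx {n : ℕ} (s : Set α) (f : s → Fin n) (x : α) (u : Fin n) : Prop :=
  ∃ a : s, (a : α) = x ∧ f a = u

/-- `deg_G(v, H[s])` for the pair of vertices `v = ((x,u),(y,w))`: the number of
canonical copies of `H[s]` in `G` containing both vertices. -/
noncomputable def degPair (H : SimpleGraph α) (n : ℕ) (G : SimpleGraph (α × Fin n)) (s : Set α)
    (x : α) (u : Fin n) (y : α) (w : Fin n) : ℕ :=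
  {f ∈ canonCopies H n G s | containsVtx s f x u ∧ containsVtx s f y w}.ncard

/-- Canonical copies of `H^J` (`J = H[s]`) in `G ⊆ K_n^H`.  A canonical copy of
`H^J` is faithfully encoded by the pair `(f, f')` of (second coordinates of)
canonical copies of `H` given by its restrictions to the two overlapping copies
of `H`; injectivity is equivalent to `f` and `f'` agreeing exactly on `s`. -/
def overlapCopies (H : SimpleGraph α) (n : ℕ) (G : SimpleGraph (α × Fin n)) (s : Set α) :
    Set ((α → Fin n) × (α → Fin n)) :=
  { ff | (∀ a b : α, H.Adj a b → G.Adj (a, ff.1 a) (b, ff.1 b)) ∧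
         (∀ a b : α, H.Adj a b → G.Adj (a, ff.2 a) (b, ff.2 b)) ∧
         (∀ a ∈ s, ff.1 a = ff.2 a) ∧ (∀ a ∉ s, ff.1 a ≠ ff.2 a) }

/-- `N_G(H^J)` for `J = H[s]`: the number of canonical copies of `H^J` in `G`. -/
noncomputable def NOverlap (H : SimpleGraph α) (n : ℕ) (G : SimpleGraph (α × Fin n))
    (s : Set α) : ℕ :=
  (overlapCopies H n G s).ncard

/-- `deg_G(v, H^J)` for the pair of vertices `v = ((x,u),(y,w))`: the number of
canonical copies of `H^J` in `G` containing both vertices. -/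
noncomputable def degPairOverlap (H : SimpleGraph α) (n : ℕ) (G : SimpleGraph (α × Fin n))
    (s : Set α) (x : α) (u : Fin n) (y : α) (w : Fin n) : ℕ :=
  {ff ∈ overlapCopies H n G s | (ff.1 x = u ∨ ff.2 x = u) ∧ (ff.1 y = w ∨ ff.2 y = w)}.ncard

/-- The graph obtained from `Ge` by adding, for each pair `(u,w) ∈ R`, the edge
between `(x,u) ∈ V_x` and `(y,w) ∈ V_y`. -/
def addPairs {n : ℕ} (Ge : SimpleGraph (α × Fin n)) (x y : α)
    (R : Set (Fin n × Fin n)) : SimpleGraph (α × Fin n) :=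
  Ge ⊔ SimpleGraph.fromEdgeSet { p : Sym2 (α × Fin n) | ∃ r ∈ R, p = s((x, r.1), (y, r.2)) }

/-- The edge set of a graph on a finite vertex type, as a finset (the board of
the Waiter-Client game played on the edges of this graph). -/
noncomputable def edgeBoard {β : Type*} (G : SimpleGraph β) [Finite β] : Finset (Sym2 β) :=
  (Set.toFinite G.edgeSet).toFinset

/-- The number of subgraphs of `G` isomorphic to `H`. -/
noncomputable def copyCount {β : Type*} (G : SimpleGraph β) (H : SimpleGraph α) : ℕ :=
  Set.ncard { G' : G.Subgraph | Nonempty (G'.coe ≃g H) }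

end GraphDefs

namespace WCAux
open WCGame Finset

/-- Recursive description of positions from which Waiter can reach a state satisfying `P`. -/
inductive Win {X : Type*} [DecidableEq X] (board : Finset X) (b : ℕ)
    (P : Finset X → Finset X → Prop) : Finset X → Finset X → Prop
  | halt (O S : Finset X) : P O S → Win board b P O S
  | step (O S Q : Finset X) : Q.card = b → Q ⊆ board → Disjoint Q O →
      (∀ x ∈ Q, Win board b P (O ∪ Q) (insert x S)) → Win board b P O S

theorem Win.bind {X : Type*} [DecidableEq X] {board : Finset X} {b : ℕ}
    {P P' : Finset X → Finset X → Prop} {O S : Finset X} (h : Win board b P O S)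
    (hh : ∀ O S, P O S → Win board b P' O S) : Win board b P' O S := by
  induction h with
  | halt O S h => exact hh _ _ h
  | step O S Q h1 h2 h3 _ ih => exact Win.step O S Q h1 h2 h3 ih

theorem offeredSet_append {X : Type*} [DecidableEq X] (h : Hist X) (r : Finset X × X) :
    offeredSet (h ++ [r]) = offeredSet h ∪ r.1 := by
  induction h with
  | nil => simp [offeredSet]
  | cons a t ih =>
    simp only [offeredSet, List.cons_append, List.foldr_cons] at ih ⊢
    rw [ih, Finset.union_assoc]

/-- elements chosen so far -/
def chosen {X : Type*} [DecidableEq X] (h : Hist X) : Finset X := (h.map Prod.snd).toFinset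

theorem chosen_append {X : Type*} [DecidableEq X] (h : Hist X) (r : Finset X × X) :
    chosen (h ++ [r]) = insert r.2 (chosen h) := by
  ext x; simp [chosen]

theorem win_ensure {X : Type*} [DecidableEq X] (board : Finset X) (b : ℕ) (hb : 1 ≤ b)
    (P : Finset X → Prop) (h : Win board b (fun _ S => P S) ∅ ∅) :
    WaiterCanEnsure board b P := by
  classical
  let good : Hist X → Finset X → Prop := fun h Q =>
    Q.card = b ∧ Q ⊆ board ∧ Disjoint Q (offeredSet h) ∧
      ∀ x ∈ Q, Win board b (fun _ S => P S) (offeredSet h ∪ Q) (insert x (chosen h))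
  let W : WaiterStrategy X := fun h =>
    if P (chosen h) then none else
      if hq : ∃ Q, good h Q then some hq.choose else none
  refine ⟨W, ?_, ?_⟩
  · intro h O hO
    simp only [W] at hO
    split_ifs at hO with h1 h2
    obtain ⟨a1, a2, a3, _⟩ := h2.choose_spec
    simp only [Option.some.injEq] at hO
    rw [hO] at a1 a2 a3
    exact ⟨a1, a2, a3⟩
  · intro C hC
    have key : ∀ fuel (h : Hist X), (board \ offeredSet h).card ≤ fuel →
        Win board b (fun _ S => P S) (offeredSet h) (chosen h) →
        P (chosen (playAux W C fuel h)) := by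
      intro fuel
      induction fuel with
      | zero =>
        intro h hf hw
        simp only [playAux]
        cases hw with
        | halt _ _ h => exact h
        | step _ _ Q h1 h2 h3 _ =>
          exfalso
          have : Q ⊆ board \ offeredSet h := by
            intro x hx
            rw [mem_sdiff]
            exact ⟨h2 hx, Finset.disjoint_left.mp h3 hx⟩
          have := card_le_card this
          omega
      | succ fuel ih =>
        intro h hf hw
        by_cases hP : P (chosen h)
        · have : W h = none := by simp [W, hP]
          simp only [playAux, this]; exact hP
        · have hex : ∃ Q, good h Q := by
            cases hw with
            | halt _ _ h => exact absurd h hP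
            | step _ _ Q h1 h2 h3 h4 => exact ⟨Q, h1, h2, h3, h4⟩
          have hW : W h = some hex.choose := by simp [W, hP, hex]
          obtain ⟨h1, h2, h3, h4⟩ := hex.choose_spec
          simp only [playAux, hW]
          set Q := hex.choose
          have hne : Q.Nonempty := by rw [← card_pos]; omega
          have hc := hC h Q hne
          apply ih
          · rw [offeredSet_append]
            have : (board \ (offeredSet h ∪ Q)) ⊂ (board \ offeredSet h) := by
              rw [Finset.ssubset_iff_of_subset (by
                apply sdiff_subset_sdiff (le_refl _) subset_union_left)]
              refine ⟨C h Q, ?_, ?_⟩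
              · rw [mem_sdiff]; exact ⟨h2 hc, Finset.disjoint_left.mp h3 hc⟩
              · simp [hc]
            have := card_lt_card this
            simp only
            omega
          · rw [offeredSet_append, chosen_append]
            exact h4 _ hc
    have := key board.card [] (by simp [offeredSet]) (by simpa [offeredSet, chosen] using h)
    exact this

theorem markov (G : Finset ℕ) (L : Finset ℕ) (k : ℕ) (hk : 0 < k) (hL : L.card ≤ k)
    (u : ℕ → ℕ → ℝ) (hu : ∀ l x, 0 ≤ u l x) (B : ℝ)
    (hB : ∀ l ∈ L, ∑ x ∈ G, u l x ≤ B) :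
    4 * (G.filter (fun x => ∃ l ∈ L, 4 * k * B / G.card < u l x)).card ≤ G.card := by
  classical
  have h1 : ∀ l ∈ L, 4 * (k : ℝ) * (G.filter (fun x => 4 * k * B / G.card < u l x)).card
      ≤ G.card := by
    intro l hl
    set H := G.filter (fun x => 4 * k * B / G.card < u l x) with hH
    rcases Finset.eq_empty_or_nonempty H with h0 | ⟨x, hx⟩
    · rw [h0]; simp
    have hG : (0 : ℝ) < G.card := by
      have : 0 < G.card := card_pos.mpr ⟨x, (mem_filter.mp hx).1⟩
      exact_mod_cast this
    have h2 : ∑ x ∈ H, (4 * k * B / G.card : ℝ) ≤ ∑ x ∈ H, u l x :=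
      sum_le_sum fun x hx => (mem_filter.mp hx).2.le
    have h3 : ∑ x ∈ H, u l x ≤ B :=
      (sum_le_sum_of_subset_of_nonneg (filter_subset _ _) (fun _ _ _ => hu _ _)).trans (hB l hl)
    have hB0 : 0 ≤ B := (sum_nonneg (fun _ _ => hu _ _)).trans h3
    rcases hB0.eq_or_lt with hB0 | hB0
    · exfalso
      have h4 := (mem_filter.mp hx).2
      have h5 : u l x ≤ ∑ x ∈ G, u l x :=
        single_le_sum (f := fun x => u l x) (fun _ _ => hu _ _) (mem_filter.mp hx).1
      have h6 := hB l hl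
      rw [← hB0] at h4 h6
      simp at h4
      linarith
    · rw [sum_const, nsmul_eq_mul] at h2
      have h4 := h2.trans h3
      rw [mul_div_assoc', div_le_iff₀ hG] at h4
      have : (4 * (k : ℝ) * H.card) * B ≤ G.card * B := by linarith
      exact le_of_mul_le_mul_right this hB0
  have h2 : (G.filter (fun x => ∃ l ∈ L, 4 * k * B / G.card < u l x)) ⊆
      L.biUnion (fun l => G.filter (fun x => 4 * k * B / G.card < u l x)) := by
    intro x hx
    simp only [mem_filter, mem_biUnion] at hx ⊢
    obtain ⟨h, l, hl, hh⟩ := hx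
    exact ⟨l, hl, h, hh⟩
  have h3 := (card_le_card h2).trans card_biUnion_le
  have h4 : 4 * (k : ℝ) * (∑ l ∈ L, (G.filter (fun x => 4 * k * B / G.card < u l x)).card : ℕ)
      ≤ k * G.card := by
    push_cast
    rw [mul_sum]
    calc _ ≤ ∑ l ∈ L, (G.card : ℝ) := sum_le_sum h1
      _ = L.card * G.card := by simp
      _ ≤ _ := by gcongr
  have h5 : k * (4 * (G.filter (fun x => ∃ l ∈ L, 4 * k * B / G.card < u l x)).card)
      ≤ k * G.card := by
    have h6 : 4 * k * (∑ l ∈ L, (G.filter (fun x => 4 * k * B / G.card < u l x)).card : ℕ)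
      ≤ k * G.card := by exact_mod_cast h4
    calc _ = 4 * k * (G.filter (fun x => ∃ l ∈ L, 4 * k * B / G.card < u l x)).card := by ring
      _ ≤ _ := Nat.mul_le_mul_left _ h3
      _ ≤ _ := h6
  exact Nat.le_of_mul_le_mul_left h5 hk

/-- Core of a single stage. -/
theorem core (board G O₀ S₀ : Finset ℕ) (b k r : ℕ) (hk : 0 < k) (hG : G ⊆ board)
    (hGO : Disjoint G O₀) (L : Finset ℕ) (hL : L.card ≤ k) (w : ℕ → ℕ → ℕ → ℝ)
    (hw : ∀ l x y, 0 ≤ w l x y) (hsymm : ∀ l x y, w l x y = w l y x)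
    (hdiag : ∀ l ∈ L, ∀ x, w l x x = 0) (B : ℝ)
    (hB : ∀ l ∈ L, ∑ y ∈ G, ∑ x ∈ G, w l x y ≤ B) (hr : 4 * (r * b) ≤ G.card)
    (hb : 4 * b ≤ G.card) (i : ℕ) (hi : i ≤ r) :
    Win board b (fun O S => ∃ T Q : Finset ℕ, T ⊆ G ∧ T.card = i ∧ S = S₀ ∪ T ∧ O = O₀ ∪ Q ∧
      Q ⊆ G ∧ Q.card ≤ i * b ∧ T ⊆ Q ∧
      (∀ l ∈ L, ∑ y ∈ T, ∑ x ∈ G, w l x y ≤ i * (4 * k * B / G.card)) ∧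
      (∀ l ∈ L, ∑ y ∈ T, ∑ x ∈ T, w l x y ≤ i ^ 2 * ((4 * k / G.card) ^ 2 * B))) O₀ S₀ := by
  classical
  induction i with
  | zero =>
    apply Win.halt
    refine ⟨∅, ∅, by simp, by simp, by simp, by simp, by simp, by simp, by simp, by simp, by simp⟩
  | succ i ih =>
    refine (ih (by omega)).bind ?_
    rintro O S ⟨T, Q, hTG, hTc, rfl, rfl, hQG, hQc, hTQ, h1, h2⟩
    have m1 := markov G L k hk hL (fun l y => ∑ x ∈ G, w l x y)
      (fun l x => sum_nonneg fun _ _ => hw _ _ _) B hB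
    have m2 := markov G L k hk hL (fun l x => ∑ y ∈ T, w l x y)
      (fun l x => sum_nonneg fun _ _ => hw _ _ _) (i * (4 * k * B / G.card)) (by
        intro l hl
        rw [sum_comm]
        exact h1 l hl)
    set A1 := G.filter (fun x => ∃ l ∈ L, 4 * k * B / G.card < ∑ z ∈ G, w l z x)
    set A2 := G.filter (fun x => ∃ l ∈ L,
      4 * k * (i * (4 * k * B / G.card)) / G.card < ∑ y ∈ T, w l x y)
    have hib : i * b ≤ r * b := Nat.mul_le_mul_right _ (by omega)
    have hcard : b ≤ (G \ (Q ∪ (A1 ∪ A2))).card := by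
      have e1 := le_card_sdiff (Q ∪ (A1 ∪ A2)) G
      have e2 := card_union_le Q (A1 ∪ A2)
      have e3 := card_union_le A1 A2
      omega
    obtain ⟨R, hR, hRc⟩ := exists_subset_card_eq hcard
    have hR' : ∀ x ∈ R, x ∈ G ∧ x ∉ Q ∧ x ∉ A1 ∧ x ∉ A2 := by
      intro x hx
      have := hR hx
      simp only [mem_sdiff, mem_union, not_or] at this
      exact ⟨this.1, this.2.1, this.2.2.1, this.2.2.2⟩
    apply Win.step _ _ R hRc (fun x hx => hG (hR' x hx).1)
    · rw [Finset.disjoint_left]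
      intro x hx hx'
      rcases mem_union.mp hx' with h | h
      · exact Finset.disjoint_left.mp hGO (hR' x hx).1 h
      · exact (hR' x hx).2.1 h
    intro x hx
    obtain ⟨g1, g2, g3, g4⟩ := hR' x hx
    have hxT : x ∉ T := fun h => g2 (hTQ h)
    apply Win.halt
    refine ⟨insert x T, Q ∪ R, ?_, ?_, ?_, ?_, ?_, ?_, ?_, ?_, ?_⟩
    · exact insert_subset g1 hTG
    · rw [card_insert_of_notMem hxT, hTc]
    · rw [union_insert]
    · rw [union_assoc]
    · exact union_subset hQG fun y hy => (hR' y hy).1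
    · have := card_union_le Q R
      rw [add_mul]; omega
    · exact insert_subset (mem_union_right _ hx) (hTQ.trans subset_union_left)
    · intro l hl
      rw [sum_insert hxT]
      have : ∑ z ∈ G, w l z x ≤ 4 * k * B / G.card := by
        by_contra hc
        exact g3 (mem_filter.mpr ⟨g1, l, hl, not_le.mp hc⟩)
      have := h1 l hl
      push_cast
      linarith
    · intro l hl
      have e1 : ∑ y ∈ T, w l x y ≤ 4 * k * (i * (4 * k * B / G.card)) / G.card := by
        by_contra hc
        exact g4 (mem_filter.mpr ⟨g1, l, hl, not_le.mp hc⟩)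
      have e2 := h2 l hl
      rw [sum_insert hxT, sum_insert hxT, hdiag l hl]
      have e3 : ∑ z ∈ T, w l z x = ∑ y ∈ T, w l x y := sum_congr rfl fun _ _ => hsymm _ _ _
      have e4 : ∑ y ∈ T, ∑ z ∈ insert x T, w l z y =
          ∑ y ∈ T, w l x y + ∑ y ∈ T, ∑ z ∈ T, w l z y := by
        rw [← sum_add_distrib]
        exact sum_congr rfl fun y _ => sum_insert hxT
      rw [e3, e4]
      have e5 : 4 * (k : ℝ) * (i * (4 * k * B / G.card)) / G.card =
          i * ((4 * k / G.card) ^ 2 * B) := by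
        ring
      have e6 : 0 ≤ (4 * (k : ℝ) / G.card) ^ 2 * B := by
        have : 0 ≤ B := (sum_nonneg fun _ _ => sum_nonneg fun _ _ => hw _ _ _).trans (hB l hl)
        positivity
      rw [e5] at e1
      push_cast
      nlinarith

/-- number of ordered pairs of distinct members of `F` on which `f` agrees -/
def off (F : Finset (ℕ × ℕ)) (f : ℕ × ℕ → ℕ) : ℕ :=
  ((F ×ˢ F).filter (fun p => p.1 ≠ p.2 ∧ f p.1 = f p.2)).card

/-- fibre size -/
def dg (F : Finset (ℕ × ℕ)) (f : ℕ × ℕ → ℕ) (x : ℕ) : ℕ := (F.filter (fun p => f p = x)).card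

theorem sum_dg_sq (F : Finset (ℕ × ℕ)) (f : ℕ × ℕ → ℕ) :
    ∑ x ∈ F.image f, (dg F f x) ^ 2 ≤ F.card + off F f := by
  classical
  have h1 : ∑ x ∈ F.image f, (dg F f x) ^ 2 =
      ((F ×ˢ F).filter (fun p => f p.1 = f p.2)).card := by
    rw [card_eq_sum_card_fiberwise (f := fun p => f p.1) (t := F.image f)]
    · apply sum_congr rfl
      intro x _
      rw [sq, dg, ← card_product]
      congr 1
      ext ⟨p, q⟩
      simp only [mem_product, mem_filter]
      constructor
      · rintro ⟨⟨a, rfl⟩, c, d⟩; exact ⟨⟨⟨a, c⟩, d.symm⟩, rfl⟩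
      · rintro ⟨⟨⟨a, c⟩, d⟩, rfl⟩; exact ⟨⟨a, rfl⟩, c, d.symm⟩
    · intro p hp
      simp only [coe_filter, mem_product, Set.mem_ofPred_eq] at hp
      exact mem_coe.mpr (mem_image_of_mem _ hp.1.1)
  rw [h1]
  have h2 : ((F ×ˢ F).filter (fun p => f p.1 = f p.2)) ⊆
      F.image (fun p => (p, p)) ∪
        ((F ×ˢ F).filter (fun p => p.1 ≠ p.2 ∧ f p.1 = f p.2)) := by
    rintro ⟨p, q⟩ h
    simp only [mem_filter, mem_product, mem_union, mem_image] at h ⊢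
    by_cases hpq : p = q
    · left; exact ⟨p, h.1.1, by rw [hpq]⟩
    · right; exact ⟨h.1, hpq, h.2⟩
  refine (card_le_card h2).trans ((card_union_le _ _).trans ?_)
  rw [off]
  exact Nat.add_le_add_right card_image_le _

theorem deg_lemma (F : Finset (ℕ × ℕ)) (f : ℕ × ℕ → ℕ) (α β D n : ℝ) (hα : 0 < α) (hβ : 0 < β)
    (hD : 0 < D) (hn : 0 < n) (hF : α * n * D ≤ F.card) (ho : (off F f : ℝ) ≤ β * n * D ^ 2)
    (hV : ((F.image f).card : ℝ) ≤ n) :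
    ∃ G ⊆ F.image f, α ^ 2 / (4 * (α + β)) * (n * min 1 D) ≤ G.card ∧
      ∀ x ∈ G, min 1 (α / 2) * max 1 D ≤ dg F f x := by
  classical
  set V := F.image f
  refine ⟨V.filter (fun x => α * D / 2 ≤ dg F f x), filter_subset _ _, ?_, ?_⟩
  · set G := V.filter (fun x => α * D / 2 ≤ dg F f x) with hG
    set A : ℝ := (F.card : ℝ) with hA
    have h1 : ∑ x ∈ V, (dg F f x : ℝ) = A := by
      rw [hA, card_eq_sum_card_image f F]; push_cast; rfl
    have h2 : ∑ x ∈ V.filter (fun x => ¬ α * D / 2 ≤ dg F f x), (dg F f x : ℝ) ≤ A / 2 := by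
      calc _ ≤ ∑ x ∈ V.filter (fun x => ¬ α * D / 2 ≤ dg F f x), (α * D / 2) :=
            sum_le_sum fun x hx => (not_le.mp (mem_filter.mp hx).2).le
        _ ≤ ∑ x ∈ V, (α * D / 2) :=
            sum_le_sum_of_subset_of_nonneg (filter_subset _ _) fun _ _ _ => by positivity
        _ = V.card * (α * D / 2) := by simp
        _ ≤ n * (α * D / 2) := by gcongr
        _ ≤ A / 2 := by linarith
    have h3 : A / 2 ≤ ∑ x ∈ G, (dg F f x : ℝ) := by
      have := sum_filter_add_sum_filter_not V (fun x => α * D / 2 ≤ dg F f x)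
        (fun x => (dg F f x : ℝ))
      rw [h1, ← hG] at this
      linarith
    have h4 : (∑ x ∈ G, (dg F f x : ℝ)) ^ 2 ≤ G.card * ∑ x ∈ G, (dg F f x : ℝ) ^ 2 :=
      sq_sum_le_card_mul_sum_sq
    have h5 : ∑ x ∈ G, (dg F f x : ℝ) ^ 2 ≤ A + β * n * D ^ 2 := by
      calc _ ≤ ∑ x ∈ V, (dg F f x : ℝ) ^ 2 :=
            sum_le_sum_of_subset_of_nonneg (filter_subset _ _) fun _ _ _ => by positivity
        _ ≤ A + off F f := by
            have h := sum_dg_sq F f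
            have h' : ((∑ x ∈ F.image f, (dg F f x) ^ 2 : ℕ) : ℝ) ≤ (F.card + off F f : ℕ) :=
              Nat.cast_le.mpr h
            push_cast at h'
            exact h'
        _ ≤ _ := by linarith
    set B := β * n * D ^ 2 with hB
    set a := α * n * D with ha
    set g : ℝ := (G.card : ℝ)
    have hg : 0 ≤ g := by positivity
    have ha0 : 0 < a := by positivity
    have hB0 : 0 < B := by positivity
    have h6 : A ^ 2 ≤ 4 * g * (A + B) := by
      have : (A / 2) ^ 2 ≤ (∑ x ∈ G, (dg F f x : ℝ)) ^ 2 := by gcongr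
      have : g * ∑ x ∈ G, (dg F f x : ℝ) ^ 2 ≤ g * (A + B) := by gcongr
      linarith
    have h7 : a ^ 2 * (A + B) ≤ 4 * g * (a + B) * (A + B) := by
      calc a ^ 2 * (A + B) = a * a * A + a ^ 2 * B := by ring
        _ ≤ a * A * A + A ^ 2 * B := by gcongr
        _ = A ^ 2 * (a + B) := by ring
        _ ≤ 4 * g * (A + B) * (a + B) := by gcongr
        _ = _ := by ring
    have h8 : a ^ 2 ≤ 4 * g * (a + B) := le_of_mul_le_mul_right h7 (by linarith)
    have h9 : α ^ 2 * n * D ≤ 4 * g * (α + β * D) := by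
      have : (α ^ 2 * n * D) * (n * D) ≤ (4 * g * (α + β * D)) * (n * D) := by
        rw [ha, hB] at h8; linarith
      exact le_of_mul_le_mul_right this (by positivity)
    rw [div_mul_eq_mul_div, div_le_iff₀ (by positivity)]
    rcases le_total D 1 with hD1 | hD1
    · rw [min_eq_right hD1]
      have : 4 * g * (α + β * D) ≤ 4 * g * (α + β * 1) := by gcongr
      linarith
    · rw [min_eq_left hD1]
      have : 4 * g * (α + β * D) ≤ 4 * g * (α * D + β * D) := by
        gcongr; nlinarith
      have : (α ^ 2 * n) * D ≤ (4 * g * (α + β)) * D := by linarith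
      have := le_of_mul_le_mul_right this hD
      linarith
  · intro x hx
    obtain ⟨hx1, hx2⟩ := mem_filter.mp hx
    have h1 : (1 : ℝ) ≤ dg F f x := by
      obtain ⟨p, hp, hpx⟩ := mem_image.mp hx1
      have : 0 < dg F f x := card_pos.mpr ⟨p, mem_filter.mpr ⟨hp, hpx⟩⟩
      exact_mod_cast this
    rcases le_total D 1 with hD1 | hD1
    · rw [max_eq_left hD1, mul_one]; exact (min_le_left _ _).trans h1
    · rw [max_eq_right hD1]
      calc min 1 (α / 2) * D ≤ α / 2 * D := by gcongr; exact min_le_right _ _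
        _ ≤ _ := by linarith

/-- pair weights -/
def wt (F : Finset (ℕ × ℕ)) (f g : ℕ × ℕ → ℕ) (x y : ℕ) : ℕ :=
  ((F ×ˢ F).filter (fun p => (p.1 ≠ p.2 ∧ g p.1 = g p.2) ∧ f p.1 = x ∧ f p.2 = y)).card

theorem wt_symm (F : Finset (ℕ × ℕ)) (f g : ℕ × ℕ → ℕ) (x y : ℕ) :
    wt F f g x y = wt F f g y x := by
  apply card_bij (fun p _ => p.swap)
  · rintro ⟨p, q⟩ h
    simp only [mem_filter, mem_product, Prod.swap] at h ⊢
    exact ⟨⟨h.1.2, h.1.1⟩, ⟨Ne.symm h.2.1.1, h.2.1.2.symm⟩, h.2.2.2, h.2.2.1⟩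
  · intro a _ b _ h; exact Prod.swap_injective h
  · rintro ⟨p, q⟩ h
    simp only [mem_filter, mem_product] at h
    refine ⟨(q, p), ?_, rfl⟩
    simp only [mem_filter, mem_product]
    exact ⟨⟨h.1.2, h.1.1⟩, ⟨Ne.symm h.2.1.1, h.2.1.2.symm⟩, h.2.2.2, h.2.2.1⟩

theorem sum_wt (F : Finset (ℕ × ℕ)) (f g : ℕ × ℕ → ℕ) (T : Finset ℕ) :
    ∑ y ∈ T, ∑ x ∈ T, wt F f g x y = off (F.filter (fun p => f p ∈ T)) g := by
  classical
  rw [off, card_eq_sum_card_fiberwise (f := fun p => (f p.2, f p.1)) (t := T ×ˢ T), sum_product]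
  · apply sum_congr rfl
    intro y hy
    apply sum_congr rfl
    intro x hx
    rw [wt]
    congr 1
    ext ⟨p, q⟩
    simp only [mem_filter, mem_product, Prod.mk.injEq]
    constructor
    · rintro ⟨⟨a, b⟩, c, rfl, rfl⟩; exact ⟨⟨⟨⟨a, hx⟩, b, hy⟩, c⟩, rfl, rfl⟩
    · rintro ⟨⟨⟨⟨a, _⟩, b, _⟩, c⟩, rfl, rfl⟩; exact ⟨⟨a, b⟩, c, rfl, rfl⟩
  · intro p hp
    simp only [coe_filter, mem_product, mem_filter, Set.mem_ofPred_eq] at hp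
    simp only [coe_product, Set.mem_prod, mem_coe]
    exact ⟨hp.1.2.2, hp.1.1.2⟩

theorem off_mono {F F' : Finset (ℕ × ℕ)} (h : F' ⊆ F) (g : ℕ × ℕ → ℕ) : off F' g ≤ off F g :=
  card_le_card (filter_subset_filter _ (product_subset_product h h))

/-- the `i`-th term -/
def pr (i : ℕ) (p : ℕ × ℕ) : ℕ := p.1 + i * p.2

/-- invariant after `j` stages -/
def Inv (F₀ : Finset (ℕ × ℕ)) (k j : ℕ) (α β n D : ℝ) (O S : Finset ℕ) : Prop :=
  (∀ l, j ≤ l → l < k → ∀ p ∈ F₀, pr l p ∉ O) ∧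
  ∃ F ⊆ F₀, (∀ p ∈ F, ∀ i < j, pr i p ∈ S) ∧ α * n * D ≤ F.card ∧
    ∀ l, j ≤ l → l < k → (off F (pr l) : ℝ) ≤ β * n * D ^ 2

theorem stage (k : ℕ) (α β : ℝ) (hα : 0 < α) (hβ : 0 < β) :
    ∃ α' β' K : ℝ, 0 < α' ∧ 0 < β' ∧ 0 < K ∧
      ∀ (n b j : ℕ) (D : ℝ) (F₀ : Finset (ℕ × ℕ)), 1 ≤ n → 1 ≤ b → j < k → 0 < D →
        K * b ≤ n → K * b ≤ n * D →
        (∀ p ∈ F₀, ∀ i < k, pr i p ∈ Finset.Icc 1 n) →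
        (∀ p ∈ F₀, ∀ q ∈ F₀, ∀ i < k, ∀ l < k, i ≠ l → pr i p ≠ pr l q) →
        ∀ O S, Inv F₀ k j α β n D O S →
          Win (Finset.Icc 1 n) b (Inv F₀ k (j + 1) α' β' n (D / b)) O S := by
  classical
  set κ := α ^ 2 / (4 * (α + β)) with hκ
  have hκ0 : 0 < κ := by positivity
  have hm0 : 0 < min 1 (α / 2) := by positivity
  refine ⟨κ * min 1 (α / 2) / 8, (k ^ 2 + 1) * β, 4 / κ, by positivity, by positivity,
    by positivity, ?_⟩
  rintro n b j D F₀ hn hb hjk hD hK1 hK2 hrange hdisj O S ⟨hO, F, hFF, hFS, hFc, hoff⟩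
  have hnR : (0 : ℝ) < n := by exact_mod_cast hn
  have hbR : (0 : ℝ) < b := by exact_mod_cast hb
  have hVsub : F.image (pr j) ⊆ Finset.Icc 1 n := by
    intro x hx
    obtain ⟨p, hp, rfl⟩ := mem_image.mp hx
    exact hrange p (hFF hp) j hjk
  have hVc : ((F.image (pr j)).card : ℝ) ≤ n := by
    have := card_le_card hVsub
    simp only [Nat.card_Icc] at this
    exact_mod_cast (by omega : (F.image (pr j)).card ≤ n)
  obtain ⟨G, hGV, hGc, hGd⟩ := deg_lemma F (pr j) α β D n hα hβ hD hnR hFc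
    (hoff j le_rfl hjk) hVc
  rw [← hκ] at hGc
  have hGb : 4 * b ≤ G.card := by
    have : (4 * b : ℝ) ≤ G.card := by
      refine le_trans ?_ hGc
      rw [div_mul_eq_mul_div, div_le_iff₀ hκ0] at hK1 hK2
      rcases le_total D 1 with h | h
      · rw [min_eq_right h]; linarith
      · rw [min_eq_left h]; linarith
    exact_mod_cast this
  set r := G.card / (4 * b) with hr
  have hr1 : r * (4 * b) ≤ G.card := Nat.div_mul_le_self _ _
  have hr2 : G.card ≤ 8 * b * r := by
    have h1 : 1 ≤ r := (Nat.one_le_div_iff (by omega)).mpr hGb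
    have h2 : G.card < (4 * b) * (r + 1) := Nat.lt_mul_div_succ _ (by omega)
    nlinarith
  have hGO : Disjoint G O := by
    rw [Finset.disjoint_left]
    intro x hx
    obtain ⟨p, hp, rfl⟩ := mem_image.mp (hGV hx)
    exact hO j le_rfl hjk p (hFF hp)
  have hB : ∀ l ∈ Finset.Ioo j k, ∑ y ∈ G, ∑ x ∈ G, (wt F (pr j) (pr l) x y : ℝ)
      ≤ β * n * D ^ 2 := by
    intro l hl
    rw [mem_Ioo] at hl
    refine le_trans ?_ (hoff l hl.1.le hl.2)
    exact_mod_cast (sum_wt F (pr j) (pr l) G).le.trans (off_mono (filter_subset _ _) _)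
  refine (core (Finset.Icc 1 n) G O S b k r (by omega) (hGV.trans hVsub) hGO (Finset.Ioo j k)
    (by simp; omega) (fun l x y => (wt F (pr j) (pr l) x y : ℝ)) (fun _ _ _ => by positivity)
    (fun l x y => congrArg _ (wt_symm F (pr j) (pr l) x y)) ?_ (β * n * D ^ 2) hB (by linarith) hGb r le_rfl).bind ?_
  · intro l hl x
    rw [mem_Ioo] at hl
    simp only [Nat.cast_eq_zero, wt, card_eq_zero]
    rw [filter_eq_empty_iff]
    rintro ⟨⟨a, d⟩, ⟨a', d'⟩⟩ _ ⟨⟨h1, h2⟩, h3, h4⟩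
    apply h1
    simp only [pr] at h2 h3 h4
    have h5 := h3.trans h4.symm
    obtain ⟨s, rfl⟩ := Nat.exists_eq_add_of_lt hl.1
    have h6 : (s + 1) * d = (s + 1) * d' := by nlinarith
    have h7 : d = d' := Nat.eq_of_mul_eq_mul_left (by omega) h6
    subst h7
    have : a = a' := by omega
    simp [this]
  · rintro O' S' ⟨T, Q, hTG, hTc, rfl, rfl, hQG, -, -, -, hT⟩
    apply Win.halt
    refine ⟨?_, F.filter (fun p => pr j p ∈ T), (filter_subset _ _).trans hFF, ?_, ?_, ?_⟩
    · intro l hl hlk p hp h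
      rcases mem_union.mp h with h | h
      · exact hO l (by omega) hlk p hp h
      · obtain ⟨q, hq, hqq⟩ := mem_image.mp (hGV (hQG h))
        exact hdisj q (hFF hq) p hp j hjk l hlk (by omega) hqq
    · intro p hp i hi
      obtain ⟨hp1, hp2⟩ := mem_filter.mp hp
      rcases Nat.lt_succ_iff_lt_or_eq.mp hi with h | rfl
      · exact mem_union_left _ (hFS p hp1 i h)
      · exact mem_union_right _ hp2
    · have h1 : ((F.filter (fun p => pr j p ∈ T)).card : ℝ) = ∑ x ∈ T, (dg F (pr j) x : ℝ) := by
        rw [card_eq_sum_card_fiberwise (f := pr j) (t := T)]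
        · push_cast
          apply sum_congr rfl
          intro x hx
          rw [dg]
          congr 2
          ext p
          simp only [mem_filter]
          constructor
          · rintro ⟨⟨a, b⟩, c⟩; exact ⟨a, c⟩
          · rintro ⟨a, rfl⟩; exact ⟨⟨a, hx⟩, rfl⟩
        · intro p hp
          exact (mem_filter.mp hp).2
      rw [h1]
      have h2 : ∑ x ∈ T, (min 1 (α / 2) * max 1 D) ≤ ∑ x ∈ T, (dg F (pr j) x : ℝ) :=
        sum_le_sum fun x hx => hGd x (hTG hx)
      refine le_trans ?_ h2
      rw [sum_const, hTc, nsmul_eq_mul]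
      have h3 : (G.card : ℝ) ≤ 8 * b * r := by exact_mod_cast hr2
      have h4 : κ * (n * min 1 D) ≤ 8 * b * r := hGc.trans h3
      have h5 : min 1 D * max 1 D = D := by rw [min_mul_max, one_mul]
      have h6 : κ * min 1 (α / 2) / 8 * n * (D / b) =
          (κ * (n * min 1 D)) * (min 1 (α / 2) * max 1 D) / (8 * b) := by
        rw [show (κ * (n * min 1 D)) * (min 1 (α / 2) * max 1 D) =
          κ * n * min 1 (α / 2) * (min 1 D * max 1 D) by ring, h5]
        field_simp
      rw [h6, div_le_iff₀ (by positivity)]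
      have h7 : 0 ≤ min 1 (α / 2) * max 1 D := by positivity
      nlinarith
    · intro l hl hlk
      have h1 := hT l (mem_Ioo.mpr ⟨hl, hlk⟩)
      have h2 : ∑ y ∈ T, ∑ x ∈ T, (wt F (pr j) (pr l) x y : ℝ) =
          (off (F.filter (fun p => pr j p ∈ T)) (pr l) : ℝ) := by
        exact_mod_cast sum_wt F (pr j) (pr l) T
      rw [h2] at h1
      refine h1.trans ?_
      have hG0 : (0 : ℝ) < G.card := by
        have : 0 < G.card := by omega
        exact_mod_cast this
      have h3 : (r : ℝ) * (4 * b) ≤ G.card := by exact_mod_cast hr1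
      have h4 : (r : ℝ) * (4 * k / G.card) ≤ k / b := by
        rw [mul_div_assoc', div_le_div_iff₀ hG0 hbR]
        have : (0 : ℝ) ≤ k := by positivity
        nlinarith
      calc (r : ℝ) ^ 2 * ((4 * k / G.card) ^ 2 * (β * n * D ^ 2))
          = ((r : ℝ) * (4 * k / G.card)) ^ 2 * (β * n * D ^ 2) := by ring
        _ ≤ (k / b) ^ 2 * (β * n * D ^ 2) := by gcongr
        _ = k ^ 2 * (β * n * (D / b) ^ 2) := by ring
        _ ≤ (k ^ 2 + 1) * (β * n * (D / b) ^ 2) := by gcongr; linarith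
        _ = _ := by ring

theorem stages (k : ℕ) (α β : ℝ) (hα : 0 < α) (hβ : 0 < β) (j : ℕ) (hj : j ≤ k) :
    ∃ α' β' K : ℝ, 0 < α' ∧ 0 < β' ∧ 0 < K ∧
      ∀ (n b : ℕ) (F₀ : Finset (ℕ × ℕ)), 1 ≤ n → 1 ≤ b →
        K * b ≤ n → K * b ^ k ≤ n ^ 2 →
        (∀ p ∈ F₀, ∀ i < k, pr i p ∈ Finset.Icc 1 n) →
        (∀ p ∈ F₀, ∀ q ∈ F₀, ∀ i < k, ∀ l < k, i ≠ l → pr i p ≠ pr l q) →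
        Inv F₀ k 0 α β n n ∅ ∅ →
          Win (Finset.Icc 1 n) b (Inv F₀ k j α' β' n (n / b ^ j)) ∅ ∅ := by
  induction j with
  | zero =>
    refine ⟨α, β, 1, hα, hβ, one_pos, ?_⟩
    intro n b F₀ _ _ _ _ _ _ h
    apply Win.halt
    simpa using h
  | succ j ih =>
    obtain ⟨α₁, β₁, K₁, h1, h2, h3, h4⟩ := ih (by omega)
    obtain ⟨α₂, β₂, K₂, g1, g2, g3, g4⟩ := stage k α₁ β₁ h1 h2
    refine ⟨α₂, β₂, max K₁ K₂, g1, g2, by positivity, ?_⟩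
    intro n b F₀ hn hb hK hK' hr hd hI
    have hbR : (1 : ℝ) ≤ b := by exact_mod_cast hb
    have hnR : (1 : ℝ) ≤ n := by exact_mod_cast hn
    refine (h4 n b F₀ hn hb (le_trans (by gcongr; exact le_max_left _ _) hK)
      (le_trans (by gcongr; exact le_max_left _ _) hK') hr hd hI).bind ?_
    intro O S hOS
    have := g4 n b j (n / b ^ j) F₀ hn hb (by omega) (by positivity)
      (le_trans (by gcongr; exact le_max_right _ _) hK) ?_ hr hd O S hOS
    · rwa [div_div, ← pow_succ] at this
    · rw [mul_div_assoc', le_div_iff₀ (by positivity)]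
      calc K₂ * b * b ^ j = K₂ * b ^ (j + 1) := by ring
        _ ≤ max K₁ K₂ * b ^ k := by
          gcongr
          · exact le_max_right _ _
        _ ≤ n * n := by rw [← sq]; exact hK'


theorem start_family (k n : ℕ) (hk : 3 ≤ k) (hn : k ^ 2 ≤ n) :
    ∃ F₀ : Finset (ℕ × ℕ), (∀ p ∈ F₀, 1 ≤ p.2) ∧
      (∀ p ∈ F₀, ∀ i < k, pr i p ∈ Finset.Icc 1 n) ∧
      (∀ p ∈ F₀, ∀ q ∈ F₀, ∀ i < k, ∀ l < k, i ≠ l → pr i p ≠ pr l q) ∧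
      Inv F₀ k 0 (1 / (4 * (k : ℝ) ^ 4)) 1 n n ∅ ∅ := by
  classical
  set m := n / k ^ 2 with hm
  have hk2 : 0 < k ^ 2 := by positivity
  have hm1 : 1 ≤ m := (Nat.one_le_div_iff hk2).mpr hn
  have hmn : m * k ^ 2 ≤ n := Nat.div_mul_le_self _ _
  have hmn' : n ≤ 2 * k ^ 2 * m := by
    have h2 : n < k ^ 2 * (m + 1) := Nat.lt_mul_div_succ _ hk2
    nlinarith
  have hmn'' : m ≤ n := by nlinarith
  have hmem : ∀ p ∈ (Finset.Icc 1 m ×ˢ Finset.Ico (k * m) (k * m + m)),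
      1 ≤ p.1 ∧ p.1 ≤ m ∧ k * m ≤ p.2 ∧ p.2 < k * m + m := by
    intro p hp
    simp only [mem_product, Finset.mem_Icc, Finset.mem_Ico] at hp
    exact ⟨hp.1.1, hp.1.2, hp.2.1, hp.2.2⟩
  have hlt : ∀ p ∈ (Finset.Icc 1 m ×ˢ Finset.Ico (k * m) (k * m + m)),
      ∀ q ∈ (Finset.Icc 1 m ×ˢ Finset.Ico (k * m) (k * m + m)), ∀ i l, i < l → l < k →
      pr i p < pr l q := by
    intro p hp q hq i l hil hlk
    obtain ⟨a1, a2, a3, a4⟩ := hmem p hp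
    obtain ⟨c1, c2, c3, c4⟩ := hmem q hq
    simp only [pr]
    have e1 : i * p.2 ≤ i * (k * m + m) := Nat.mul_le_mul_left _ a4.le
    have e2 : (i + 1) * (k * m) ≤ l * q.2 := Nat.mul_le_mul hil c3
    have e3 : (i + 1) * m ≤ k * m := Nat.mul_le_mul_right _ (by omega)
    nlinarith
  refine ⟨Finset.Icc 1 m ×ˢ Finset.Ico (k * m) (k * m + m), ?_, ?_, ?_, ?_, _, subset_rfl,
    ?_, ?_, ?_⟩
  · intro p hp
    have := (hmem p hp).2.2.1
    nlinarith
  · intro p hp i hi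
    obtain ⟨a1, a2, a3, a4⟩ := hmem p hp
    rw [Finset.mem_Icc, pr]
    refine ⟨by omega, le_trans ?_ hmn⟩
    obtain ⟨s, rfl⟩ : ∃ s, k = s + 1 := ⟨k - 1, by omega⟩
    have e1 : i * p.2 ≤ s * ((s + 1) * m + m) := Nat.mul_le_mul (by omega) a4.le
    nlinarith
  · intro p hp q hq i hi l hl hil
    rcases lt_or_gt_of_ne hil with h | h
    · exact (hlt p hp q hq i l h hl).ne
    · exact (hlt q hq p hp l i h hi).ne'
  · simp
  · intro p _ i hi; omega
  · rw [card_product]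
    simp only [Nat.card_Icc, Nat.card_Ico, Nat.add_sub_cancel, Nat.add_sub_cancel_left]
    have : (n : ℝ) ≤ 2 * k ^ 2 * m := by exact_mod_cast hmn'
    have hkR : (0 : ℝ) < k := by exact_mod_cast (by omega : 0 < k)
    push_cast
    calc 1 / (4 * (k : ℝ) ^ 4) * n * n = ((n : ℝ) / (2 * k ^ 2)) * (n / (2 * k ^ 2)) := by
          field_simp; ring
      _ ≤ (m : ℝ) * m := by
          have : (n : ℝ) / (2 * k ^ 2) ≤ m := by
            rw [div_le_iff₀ (by positivity)]; linarith
          gcongr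
  · intro l _ _
    have h1 : off (Finset.Icc 1 m ×ˢ Finset.Ico (k * m) (k * m + m)) (pr l) ≤ m * m * m := by
      have : ((Finset.Icc 1 m ×ˢ Finset.Ico (k * m) (k * m + m)) ×ˢ
          Finset.Ico (k * m) (k * m + m)).card = m * m * m := by
        simp [card_product]
      rw [← this, off]
      apply card_le_card_of_injOn (fun p => (p.1, p.2.2))
      · rintro ⟨p, q⟩ h
        simp only [coe_filter, mem_product, Set.mem_ofPred_eq] at h
        simp only [mem_coe, mem_product]
        exact ⟨h.1.1, h.1.2.2⟩
      · rintro ⟨p, q⟩ h ⟨p', q'⟩ h' he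
        replace h := mem_filter.mp (mem_coe.mp h)
        replace h' := mem_filter.mp (mem_coe.mp h')
        simp only [pr] at h h'
        simp only [Prod.mk.injEq] at he
        obtain ⟨rfl, he⟩ := he
        have e1 := h.2.2
        have e2 := h'.2.2
        rw [he] at e1
        have : q.1 = q'.1 := by omega
        rw [Prod.ext this he]
    have h2 : m * m * m ≤ n * n * n := by gcongr
    have h3 : (off (Finset.Icc 1 m ×ˢ Finset.Ico (k * m) (k * m + m)) (pr l) : ℝ) ≤ n * n * n := by
      exact_mod_cast h1.trans h2
    linarith

end WCAux

open Filter WCGame in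
/-- for every `k ≥ 3` there are `c, γ > 0` such that for all large
`n` and `1 ≤ b ≤ c·n^(2/k)`, in the `b`-Waiter-Client game on `{1,…,n}`, Waiter
can ensure that Client's final set contains at least `γ·n²/b^k` `k`-term
arithmetic progressions (counted as pairs `(a, d)` with `d ≥ 1`). -/
theorem waiter_client_arithmetic_progressions (k : ℕ) (hk : 3 ≤ k) :
    ∃ c γ : ℝ, 0 < c ∧ 0 < γ ∧
      ∀ᶠ n : ℕ in atTop, ∀ b : ℕ, 1 ≤ b → (b : ℝ) ≤ c * (n : ℝ) ^ ((2 : ℝ) / k) →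
        WaiterCanEnsure (Finset.Icc 1 n) b
          (fun S => γ * (n : ℝ) ^ 2 / (b : ℝ) ^ k ≤
            (Set.ncard { ad : ℕ × ℕ | 1 ≤ ad.2 ∧ ∀ i < k, ad.1 + i * ad.2 ∈ S } : ℝ)) := by
  classical
  have hkR : (3 : ℝ) ≤ k := by exact_mod_cast hk
  obtain ⟨α, β, K, hα, hβ, hK, H⟩ := WCAux.stages k (1 / (4 * (k : ℝ) ^ 4)) 1 (by positivity)
    one_pos k le_rfl
  refine ⟨1 / max 1 K, α, by positivity, hα, ?_⟩
  filter_upwards [Filter.eventually_ge_atTop (k ^ 2)] with n hn b hb hbn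
  obtain ⟨F₀, hF1, hF2, hF3, hF4⟩ := WCAux.start_family k n hk hn
  have hn1 : 1 ≤ n := le_trans (Nat.one_le_pow _ _ (by omega)) hn
  have hnR : (1 : ℝ) ≤ n := by exact_mod_cast hn1
  have hbR : (1 : ℝ) ≤ b := by exact_mod_cast hb
  set K' := max 1 K with hK'
  have hK1 : 1 ≤ K' := le_max_left _ _
  have hK2 : K ≤ K' := le_max_right _ _
  have hK0 : 0 < K' := by linarith
  have hb1 : K' * b ≤ (n : ℝ) ^ ((2 : ℝ) / k) := by
    rw [div_mul_eq_mul_div, one_mul, le_div_iff₀ hK0] at hbn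
    linarith
  have c1 : K * b ≤ n := by
    calc K * b ≤ K' * b := by gcongr
      _ ≤ (n : ℝ) ^ ((2 : ℝ) / k) := hb1
      _ ≤ (n : ℝ) ^ (1 : ℝ) := by
        apply Real.rpow_le_rpow_of_exponent_le hnR
        rw [div_le_one (by linarith)]; linarith
      _ = n := Real.rpow_one _
  have c2 : K * b ^ k ≤ (n : ℝ) ^ 2 := by
    calc K * b ^ k ≤ K' ^ k * b ^ k := by
          gcongr
          exact hK2.trans (le_self_pow₀ hK1 (by omega))
      _ = (K' * b) ^ k := by ring
      _ ≤ ((n : ℝ) ^ ((2 : ℝ) / k)) ^ k := by gcongr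
      _ = (n : ℝ) ^ 2 := by
        rw [← Real.rpow_natCast, ← Real.rpow_mul (by linarith), div_mul_cancel₀ _ (by linarith)]
        norm_num
  apply WCAux.win_ensure _ _ hb
  refine (H n b F₀ hn1 hb c1 c2 hF2 hF3 hF4).bind ?_
  rintro O S ⟨-, F, hFF, hFS, hFc, -⟩
  apply WCAux.Win.halt
  have hfin : { ad : ℕ × ℕ | 1 ≤ ad.2 ∧ ∀ i < k, ad.1 + i * ad.2 ∈ S }.Finite := by
    apply Set.Finite.subset (Finset.finite_toSet
      (Finset.range (S.sup id + 1) ×ˢ Finset.range (S.sup id + 1)))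
    rintro ⟨a, d⟩ ⟨_, h⟩
    have h1 := Finset.le_sup (f := id) (h 1 (by omega))
    simp only [id] at h1
    simp only [Finset.mem_coe, Finset.mem_product, Finset.mem_range]
    omega
  have hle : F.card ≤ Set.ncard { ad : ℕ × ℕ | 1 ≤ ad.2 ∧ ∀ i < k, ad.1 + i * ad.2 ∈ S } := by
    rw [← Set.ncard_coe_finset]
    apply Set.ncard_le_ncard _ hfin
    intro p hp
    exact ⟨hF1 p (hFF hp), fun i hi => hFS p hp i hi⟩
  have hle' : (F.card : ℝ) ≤
      (Set.ncard { ad : ℕ × ℕ | 1 ≤ ad.2 ∧ ∀ i < k, ad.1 + i * ad.2 ∈ S } : ℝ) := by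
    exact_mod_cast hle
  refine le_trans ?_ (hFc.trans hle')
  apply le_of_eq
  ring
end

section
/- For every graph H with at least one edge, the function n^{2−1/m(H)} is a threshold for the property of containing H in the random graph G(n, m): if m = m(n) satisfies m(n)/n^{2−1/m(H)} → ∞ as n → ∞ (and m(n) ≤ C(n,2)), then the probability that G(n, m(n)) contains a subgraph isomorphic to H tends to 1, and if m(n)/n^{2−1/m(H)} → 0, then this probability tends to 0. -/
/-- The probability that the Erdős–Rényi random graph `G(n, m)` (a uniformly
random graph on `Fin n` with exactly `m` edges, encoded by its edge set, a set
of non-diagonal elements of `Sym2 (Fin n)`) contains a subgraph isomorphic to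
`H`, i.e. admits an injective graph homomorphism from `H`. -/
noncomputable def containsProb {α : Type*} [Fintype α] (H : SimpleGraph α) (n m : ℕ) : ℝ :=
  (Set.ncard { E : Finset (Sym2 (Fin n)) | (∀ e ∈ E, ¬ e.IsDiag) ∧ E.card = m ∧
      ∃ f : H →g SimpleGraph.fromEdgeSet (↑E : Set (Sym2 (Fin n))),
        Function.Injective f } : ℝ) /
  (Set.ncard { E : Finset (Sym2 (Fin n)) | (∀ e ∈ E, ¬ e.IsDiag) ∧ E.card = m } : ℝ)

namespace SmallSub
open Finset

/-- falling-factorial ratio -/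
noncomputable def Pr (N m k : ℕ) : ℝ := ∏ i ∈ range k, ((m - i : ℕ) : ℝ) / ((N - i : ℕ) : ℝ)

lemma fac_nonneg (N m i : ℕ) : 0 ≤ ((m - i : ℕ) : ℝ) / ((N - i : ℕ) : ℝ) := by positivity

lemma Pr_nonneg (N m k : ℕ) : 0 ≤ Pr N m k := prod_nonneg fun i _ => fac_nonneg N m i

lemma fac_le (N m i j : ℕ) (h : m ≤ N) :
    ((m - (j + i) : ℕ) : ℝ) / ((N - (j + i) : ℕ) : ℝ) ≤ ((m - i : ℕ) : ℝ) / ((N - i : ℕ) : ℝ) := by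
  by_cases h1 : m ≤ j + i
  · rw [Nat.sub_eq_zero_of_le h1]
    simpa using fac_nonneg N m i
  · push Not at h1
    have a1 : (0:ℝ) < ((N - (j + i) : ℕ) : ℝ) := by
      exact_mod_cast (by omega : 0 < N - (j+i))
    have a2 : (0:ℝ) < ((N - i : ℕ) : ℝ) := by
      exact_mod_cast (by omega : 0 < N - i)
    rw [div_le_div_iff₀ a1 a2]
    rw [Nat.cast_sub (by omega), Nat.cast_sub (by omega), Nat.cast_sub (by omega),
      Nat.cast_sub (by omega)]
    push_cast
    have : (m:ℝ) ≤ N := by exact_mod_cast h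
    nlinarith [mul_nonneg (sub_nonneg.2 this) (Nat.cast_nonneg (α := ℝ) j)]

lemma Pr_le_pow (N m k : ℕ) (h : m ≤ N) : Pr N m k ≤ ((m:ℝ)/N)^k := by
  unfold Pr
  calc _ ≤ ∏ i ∈ range k, ((m:ℝ)/N) := by
        apply prod_le_prod (fun i _ => fac_nonneg N m i)
        intro i _
        simpa using fac_le N m 0 i h
    _ = _ := by simp [div_pow]

lemma Pr_add_le (N m j l : ℕ) (h : m ≤ N) : Pr N m (j + l) ≤ Pr N m j * Pr N m l := by
  unfold Pr
  rw [prod_range_add]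
  apply mul_le_mul_of_nonneg_left _ (Pr_nonneg N m j)
  exact prod_le_prod (fun i _ => fac_nonneg N m _) fun i _ => fac_le N m i j h

lemma Pr_pos (N m k : ℕ) (h : m ≤ N) (hk : k ≤ m) : 0 < Pr N m k := by
  apply prod_pos
  intro i hi
  have := mem_range.1 hi
  have a1 : (0:ℝ) < ((m - i : ℕ) : ℝ) := by exact_mod_cast (by omega : 0 < m - i)
  have a2 : (0:ℝ) < ((N - i : ℕ) : ℝ) := by exact_mod_cast (by omega : 0 < N - i)
  positivity

lemma Pr_sub_le (N m e k : ℕ) (h : m ≤ N) (hk : k ≤ e) (he : 2 * e ≤ m) (h0 : 0 < m) :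
    Pr N m (e - k) ≤ Pr N m e * (2 * N / m : ℝ)^k := by
  obtain ⟨l, rfl⟩ := Nat.exists_eq_add_of_le' hk
  rw [Nat.add_sub_cancel]
  have hm : (0:ℝ) < m := by exact_mod_cast h0
  have hN : (0:ℝ) < N := by exact_mod_cast (by omega : 0 < N)
  have : Pr N m l * (m / (2 * N) : ℝ)^k ≤ Pr N m (l + k) := by
    unfold Pr
    rw [prod_range_add]
    apply mul_le_mul_of_nonneg_left _ (Pr_nonneg N m l)
    rw [← card_range k, ← prod_const, card_range]
    apply prod_le_prod
    · intros; positivity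
    · intro i hi
      have := mem_range.1 hi
      have a2 : (0:ℝ) < ((N - (l+i) : ℕ) : ℝ) := by exact_mod_cast (by omega : 0 < N - (l+i))
      rw [div_le_div_iff₀ (by positivity) a2]
      have b1 : ((N - (l+i) : ℕ) : ℝ) ≤ N := by exact_mod_cast Nat.sub_le _ _
      have b2 : (m:ℝ) ≤ 2 * ((m - (l+i) : ℕ) : ℝ) := by exact_mod_cast (by omega)
      nlinarith
  calc Pr N m l = (Pr N m l * (m / (2 * N) : ℝ)^k) * (2 * N / m : ℝ)^k := by
        rw [mul_assoc, ← mul_pow]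
        have : (m / (2 * N) : ℝ) * (2 * N / m) = 1 := by field_simp
        rw [this]; simp
    _ ≤ _ := by gcongr

lemma Pr_choose (N m k : ℕ) (hk : k ≤ m) (h : m ≤ N) :
    ((N - k).choose (m - k) : ℝ) = Pr N m k * (N.choose m : ℝ) := by
  induction k with
  | zero => simp [Pr]
  | succ k ih =>
    have ih := ih (by omega)
    unfold Pr at ih ⊢
    rw [prod_range_succ]
    have a2 : (0:ℝ) < ((N - k : ℕ) : ℝ) := by exact_mod_cast (by omega : 0 < N - k)
    have key : (N - k) * (N - (k+1)).choose (m - (k+1)) = (N-k).choose (m-k) * (m-k) := by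
      have := Nat.add_one_mul_choose_eq (N - (k+1)) (m - (k+1))
      rwa [show N - (k+1) + 1 = N - k by omega, show m - (k+1) + 1 = m - k by omega] at this
    have key' : ((N - k : ℕ):ℝ) * ((N - (k+1)).choose (m - (k+1)) : ℝ)
      = ((N-k).choose (m-k) : ℝ) * ((m-k : ℕ) : ℝ) := by exact_mod_cast key
    rw [ih] at key'
    field_simp
    linarith

lemma card_superset {β : Type*} [DecidableEq β] (Ω A : Finset β) (m : ℕ) (hA : A ⊆ Ω)
    (hm : m ≤ #Ω) :
    (#{E ∈ powersetCard m Ω | A ⊆ E} : ℝ) = Pr #Ω m #A * ((#Ω).choose m : ℝ) := by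
  by_cases h : #A ≤ m
  · rw [← Pr_choose _ _ _ h hm]
    rw [← card_sdiff_of_subset hA, ← card_powersetCard]
    norm_cast
    symm
    apply card_bij (fun B _ => A ∪ B)
    · intro B hB
      rw [mem_powersetCard] at hB
      have hd : Disjoint A B := disjoint_of_subset_right hB.1 disjoint_sdiff
      simp only [mem_filter, mem_powersetCard, card_union_of_disjoint hd]
      exact ⟨⟨union_subset hA (hB.1.trans sdiff_subset), by omega⟩, subset_union_left⟩
    · intro B hB C hC hBC
      rw [mem_powersetCard] at hB hC
      have hd : Disjoint A B := disjoint_of_subset_right hB.1 disjoint_sdiff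
      have hd' : Disjoint A C := disjoint_of_subset_right hC.1 disjoint_sdiff
      have := congrArg (· \ A) hBC
      simpa [union_sdiff_left, sdiff_eq_self_of_disjoint hd.symm,
        sdiff_eq_self_of_disjoint hd'.symm] using this
    · intro E hE
      simp only [mem_filter, mem_powersetCard] at hE
      refine ⟨E \ A, ?_, by simp [union_eq_right.2 hE.2]⟩
      rw [mem_powersetCard, card_sdiff_of_subset hE.2]
      exact ⟨sdiff_subset_sdiff hE.1.1 le_rfl, by omega⟩
  · push Not at h
    have h1 : ({E ∈ powersetCard m Ω | A ⊆ E} : Finset _) = ∅ := by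
      apply filter_eq_empty_iff.2
      intro E hE hAE
      have := card_le_card hAE
      rw [mem_powersetCard] at hE
      omega
    have h2 : Pr #Ω m #A = 0 := prod_eq_zero (mem_range.2 h) (by simp)
    rw [h1, h2]; simp

/-- all potential edges -/
def Om (n : ℕ) : Finset (Sym2 (Fin n)) := univ.filter (fun e => ¬ e.IsDiag)

lemma card_Om (n : ℕ) : #(Om n) = n.choose 2 := by
  have := Sym2.card_subtype_not_diag (α := Fin n)
  rw [Fintype.card_subtype] at this
  simpa [Om] using this

/-- image of the edges of `K` -/
noncomputable def Ed {β : Type*} [Finite β] (K : SimpleGraph β) {n : ℕ} (f : β ↪ Fin n) :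
    Finset (Sym2 (Fin n)) := (Set.toFinite K.edgeSet).toFinset.map f.sym2Map

lemma card_Ed {β : Type*} [Finite β] (K : SimpleGraph β) {n : ℕ} (f : β ↪ Fin n) :
    #(Ed K f) = K.edgeSet.ncard := by
  rw [Ed, card_map, Set.ncard_eq_toFinset_card _ (Set.toFinite _)]

lemma Ed_sub_Om {β : Type*} [Finite β] (K : SimpleGraph β) {n : ℕ} (f : β ↪ Fin n) :
    Ed K f ⊆ Om n := by
  intro e he
  simp only [Ed, mem_map, Set.Finite.mem_toFinset] at he
  obtain ⟨a, ha, rfl⟩ := he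
  induction a with
  | _ x y =>
    simp only [SimpleGraph.mem_edgeSet] at ha
    simp [Om, ha.ne]

lemma contains_iff {β : Type*} [Finite β] (K : SimpleGraph β) {n : ℕ}
    (E : Finset (Sym2 (Fin n))) :
    (∃ f : K →g SimpleGraph.fromEdgeSet (↑E : Set (Sym2 (Fin n))), Function.Injective f) ↔
      ∃ f : β ↪ Fin n, Ed K f ⊆ E := by
  constructor
  · rintro ⟨f, hf⟩
    refine ⟨⟨f, hf⟩, ?_⟩
    intro e he
    simp only [Ed, mem_map, Set.Finite.mem_toFinset] at he
    obtain ⟨a, ha, rfl⟩ := he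
    induction a with
    | _ x y =>
      have := f.map_adj ha
      rw [SimpleGraph.fromEdgeSet_adj] at this
      simpa using this.1
  · rintro ⟨f, hf⟩
    refine ⟨⟨f, ?_⟩, f.injective⟩
    intro x y h
    rw [SimpleGraph.fromEdgeSet_adj]
    refine ⟨?_, fun h' => h.ne (f.injective h')⟩
    apply hf
    simp only [Ed, mem_map, Set.Finite.mem_toFinset]
    exact ⟨s(x,y), h, by simp⟩

open Classical in
lemma prob_eq {α : Type*} [Fintype α] (H : SimpleGraph α) (n m : ℕ) :
    containsProb H n m =
      (#{E ∈ powersetCard m (Om n) | ∃ f : α ↪ Fin n, Ed H f ⊆ E} : ℝ) /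
        ((n.choose 2).choose m : ℝ) := by
  unfold containsProb
  congr 2
  · rw [← Set.ncard_coe_finset]
    congr 1
    ext E
    simp only [contains_iff, Set.mem_ofPred_eq, coe_filter, mem_powersetCard, subset_iff, Om,
      mem_filter, mem_univ, true_and, and_assoc]
  · rw [← card_Om, ← card_powersetCard, ← Set.ncard_coe_finset]
    congr 1
    ext E
    simp only [Set.mem_ofPred_eq, mem_coe, mem_powersetCard, subset_iff, Om,
      mem_filter, mem_univ, true_and]

open Classical in
lemma first_moment {β : Type*} [Fintype β] (K : SimpleGraph β) (n m : ℕ) (hm : m ≤ n.choose 2) :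
    (#{E ∈ powersetCard m (Om n) | ∃ f : β ↪ Fin n, Ed K f ⊆ E} : ℝ) ≤
      (n:ℝ)^(Fintype.card β) * ((m:ℝ)/(n.choose 2 : ℕ))^(K.edgeSet.ncard) *
        ((n.choose 2).choose m : ℝ) := by
  have h1 : ({E ∈ powersetCard m (Om n) | ∃ f : β ↪ Fin n, Ed K f ⊆ E} : Finset _) ⊆
      (univ : Finset (β ↪ Fin n)).biUnion
        (fun f => {E ∈ powersetCard m (Om n) | Ed K f ⊆ E}) := by
    intro E
    simp only [mem_filter, mem_biUnion, mem_univ, true_and]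
    rintro ⟨a, f, b⟩
    exact ⟨f, a, b⟩
  have h2 := (card_le_card h1).trans card_biUnion_le
  have h3 : (#{E ∈ powersetCard m (Om n) | ∃ f : β ↪ Fin n, Ed K f ⊆ E} : ℝ) ≤
      ∑ f : β ↪ Fin n, (#{E ∈ powersetCard m (Om n) | Ed K f ⊆ E} : ℝ) := by
    exact_mod_cast h2
  refine h3.trans ?_
  have h4 : ∀ f ∈ (univ : Finset (β ↪ Fin n)), (#{E ∈ powersetCard m (Om n) | Ed K f ⊆ E} : ℝ) ≤
      ((m:ℝ)/(n.choose 2 : ℕ))^(K.edgeSet.ncard) * ((n.choose 2).choose m : ℝ) := by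
    intro f _
    rw [card_superset _ _ _ (Ed_sub_Om K f) (by rwa [card_Om]), card_Om, card_Ed]
    gcongr
    exact Pr_le_pow _ _ _ hm
  refine (sum_le_card_nsmul _ _ _ h4).trans ?_
  rw [nsmul_eq_mul, mul_assoc]
  gcongr
  rw [card_univ, Fintype.card_embedding_eq, Fintype.card_fin]
  exact_mod_cast Nat.descFactorial_le_pow _ _


open GraphDefs

lemma dens_finite {α : Type*} [Fintype α] [DecidableEq α] (H : SimpleGraph α) :
    { d : ℝ | ∃ H' : H.Subgraph, H'.verts.Nonempty ∧
          d = (H'.edgeSet.ncard : ℝ) / (H'.verts.ncard : ℝ) }.Finite := by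
  apply (Set.finite_range (fun H' : H.Subgraph =>
    (H'.edgeSet.ncard : ℝ) / (H'.verts.ncard : ℝ))).subset
  rintro d ⟨H', _, rfl⟩
  exact ⟨H', rfl⟩

lemma dens_ge {α : Type*} [Fintype α] [DecidableEq α] (H : SimpleGraph α) (H' : H.Subgraph)
    (h : H'.verts.Nonempty) :
    (H'.edgeSet.ncard : ℝ) / (H'.verts.ncard : ℝ) ≤ maxDensity H :=
  le_csSup (dens_finite H).bddAbove ⟨H', h, rfl⟩

lemma dens_half {α : Type*} [Fintype α] [DecidableEq α] (H : SimpleGraph α)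
    (hH : H.edgeSet.Nonempty) : 1 / 2 ≤ maxDensity H := by
  obtain ⟨e, he⟩ := hH
  induction e with
  | _ x y =>
    have hxy : H.Adj x y := he
    have := dens_ge H (H.subgraphOfAdj hxy) (by simp)
    rw [SimpleGraph.edgeSet_subgraphOfAdj, SimpleGraph.subgraphOfAdj_verts,
      Set.ncard_pair hxy.ne, Set.ncard_singleton] at this
    exact_mod_cast this

lemma dens_attained {α : Type*} [Fintype α] [DecidableEq α] (H : SimpleGraph α)
    (hH : H.edgeSet.Nonempty) : ∃ H' : H.Subgraph, H'.verts.Nonempty ∧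
          maxDensity H = (H'.edgeSet.ncard : ℝ) / (H'.verts.ncard : ℝ) := by
  apply Set.Nonempty.csSup_mem _ (dens_finite H)
  obtain ⟨e, he⟩ := hH
  induction e with
  | _ x y => exact ⟨_, ⊤, ⟨x, by simp⟩, rfl⟩

lemma eIn_le {α : Type*} [Fintype α] [DecidableEq α] (H : SimpleGraph α) (s : Finset α)
    (hs : s.Nonempty) : (eIn H (s : Set α) : ℝ) ≤ maxDensity H * #s := by
  have h := dens_ge H ((⊤ : H.Subgraph).induce s) (by simpa using hs)
  have h1 : ((⊤ : H.Subgraph).induce (s : Set α)).edgeSet =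
      {e ∈ H.edgeSet | ∀ v ∈ e, v ∈ (s : Set α)} := by
    ext e
    induction e with
    | _ x y =>
      simp
      tauto
  rw [h1, SimpleGraph.Subgraph.induce_verts, Set.ncard_coe_finset, div_le_iff₀ ?_] at h
  · exact h
  · exact_mod_cast hs.card_pos

/-- vertices of the second copy lying in the first copy -/
def Sv {α : Type*} [Fintype α] {n : ℕ} (f g : α ↪ Fin n) : Finset α :=
  univ.filter (fun a => g a ∈ univ.map f)

lemma inter_le {α : Type*} [Fintype α] [DecidableEq α] (H : SimpleGraph α) {n : ℕ}
    (f g : α ↪ Fin n) : #(Ed H f ∩ Ed H g) ≤ eIn H (Sv f g : Set α) := by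
  unfold eIn
  rw [Set.ncard_eq_toFinset_card _ (Set.toFinite _), ← card_map g.sym2Map]
  apply card_le_card
  intro e he
  simp only [Ed, mem_inter, mem_map, Set.Finite.mem_toFinset] at he
  obtain ⟨⟨a, ha, h1⟩, ⟨b, hb, rfl⟩⟩ := he
  simp only [mem_map, Set.Finite.mem_toFinset]
  refine ⟨b, ⟨hb, ?_⟩, rfl⟩
  intro v hv
  have : g v ∈ g.sym2Map b := by
    rw [Function.Embedding.sym2Map_apply, Sym2.mem_map]
    exact ⟨v, hv, rfl⟩
  rw [← h1] at this
  simp only [Function.Embedding.sym2Map_apply, Sym2.mem_map] at this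
  obtain ⟨w, _, hw⟩ := this
  simp only [Sv, coe_filter, mem_map, mem_univ, true_and]
  exact ⟨w, hw⟩

lemma fiber_card {α : Type*} [Fintype α] [DecidableEq α] {n : ℕ} (f : α ↪ Fin n) (S : Finset α) :
    #{g : α ↪ Fin n | Sv f g = S} ≤
      (Fintype.card α)^(#S) * n^(Fintype.card α - #S) := by
  have h1 : #(Fintype.piFinset (fun a => if a ∈ S then univ.map f else (univ : Finset (Fin n)))) =
      (Fintype.card α)^(#S) * n^(Fintype.card α - #S) := by
    rw [Fintype.card_piFinset]
    have : ∀ a : α, #(if a ∈ S then univ.map f else (univ : Finset (Fin n))) =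
      if a ∈ S then Fintype.card α else n := by
      intro a; split_ifs <;> simp
    simp only [this]
    rw [prod_ite, prod_const, prod_const]
    congr 2
    · simp
    · rw [filter_not, card_sdiff_of_subset (filter_subset _ _)]; simp
  rw [← h1]
  apply card_le_card_of_injOn (fun g : α ↪ Fin n => (g : α → Fin n))
  · intro g hg
    simp only [coe_filter, mem_univ, true_and, Set.mem_ofPred_eq] at hg
    simp only [mem_coe, Fintype.mem_piFinset]
    intro a
    split_ifs with ha
    · rw [← hg] at ha
      exact (mem_filter.1 ha).2
    · simp
  · intro g _ g' _ h
    exact DFunLike.coe_injective h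

lemma fiber_sum {α : Type*} [Fintype α] [DecidableEq α] [Nonempty α] {n : ℕ} (f : α ↪ Fin n)
    (q y : ℝ) (hy : 0 ≤ y) (hy1 : y ≤ 1) (hq : q = n * y) :
    ∑ g : α ↪ Fin n, (if Sv f g = ∅ then 0 else q ^ #(Sv f g)) ≤
      2^(Fintype.card α) * ((Fintype.card α : ℝ)^(Fintype.card α) * (n:ℝ)^(Fintype.card α) * y) := by
  rw [← sum_fiberwise univ (fun g => Sv f g)]
  have key : ∀ S ∈ (univ : Finset (Finset α)),
      ∑ g : α ↪ Fin n with Sv f g = S, (if Sv f g = ∅ then 0 else q ^ #(Sv f g)) ≤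
      (Fintype.card α : ℝ)^(Fintype.card α) * (n:ℝ)^(Fintype.card α) * y := by
    intro S _
    have hv : (1:ℝ) ≤ Fintype.card α := by exact_mod_cast Fintype.card_pos
    by_cases hS : S = ∅
    · rw [sum_eq_zero]
      · positivity
      · intro g hg
        rw [if_pos ((mem_filter.1 hg).2.trans hS)]
    · have : ∀ g ∈ ({g : α ↪ Fin n | Sv f g = S} : Finset _),
        (if Sv f g = ∅ then 0 else q ^ #(Sv f g)) = q ^ #S := by
        intro g hg
        rw [(mem_filter.1 hg).2, if_neg hS]
      rw [sum_congr rfl this, sum_const, nsmul_eq_mul]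
      have hc : (#{g : α ↪ Fin n | Sv f g = S} : ℝ) ≤
        (Fintype.card α : ℝ)^(#S) * (n:ℝ)^(Fintype.card α - #S) := by
        exact_mod_cast fiber_card f S
      have hSv : #S ≤ Fintype.card α := card_le_univ S
      have hS1 : 1 ≤ #S := card_pos.2 (nonempty_iff_ne_empty.2 hS)
      have hq0 : 0 ≤ q := by rw [hq]; positivity
      calc _ ≤ (Fintype.card α : ℝ)^(#S) * (n:ℝ)^(Fintype.card α - #S) * q ^ #S := by gcongr
        _ = (Fintype.card α : ℝ)^(#S) * ((n:ℝ)^(Fintype.card α - #S) * (n:ℝ)^(#S)) * y ^ #S := by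
          rw [hq, mul_pow]; ring
        _ = (Fintype.card α : ℝ)^(#S) * (n:ℝ)^(Fintype.card α) * y ^ #S := by
          rw [← pow_add, Nat.sub_add_cancel hSv]
        _ ≤ (Fintype.card α : ℝ)^(Fintype.card α) * (n:ℝ)^(Fintype.card α) * y ^ 1 := by
          gcongr ?_ * _ * ?_
          · exact pow_le_pow_right₀ hv hSv
          · exact pow_le_pow_of_le_one hy hy1 hS1
        _ = _ := by rw [pow_one]
  refine (sum_le_card_nsmul _ _ _ key).trans ?_
  rw [nsmul_eq_mul, card_univ, Fintype.card_finset]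
  push_cast
  exact le_rfl

lemma pair_bound {α : Type*} [Fintype α] [DecidableEq α] (H : SimpleGraph α) {n m : ℕ}
    (f g : α ↪ Fin n) (hm : m ≤ n.choose 2) (he : 2 * H.edgeSet.ncard ≤ m) (h0 : 0 < m) :
    Pr (n.choose 2) m #(Ed H f ∪ Ed H g) ≤ Pr (n.choose 2) m H.edgeSet.ncard ^ 2 *
      (1 + if Sv f g = ∅ then 0 else (((n:ℝ)^2 / m) ^ maxDensity H) ^ #(Sv f g)) := by
  set e := H.edgeSet.ncard with hee
  set k := #(Ed H f ∩ Ed H g) with hk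
  have h1 : #(Ed H f ∪ Ed H g) = e + (e - k) := by
    have := card_union_add_card_inter (Ed H f) (Ed H g)
    have h2 := card_le_card (inter_subset_left : Ed H f ∩ Ed H g ⊆ Ed H f)
    rw [card_Ed] at h2
    rw [card_Ed, card_Ed] at this
    omega
  have hke : k ≤ e := by
    have h2 := card_le_card (inter_subset_left : Ed H f ∩ Ed H g ⊆ Ed H f)
    rwa [card_Ed] at h2
  have hP := Pr_nonneg (n.choose 2) m e
  have hmr : (0:ℝ) < m := by exact_mod_cast h0
  have h3 : Pr (n.choose 2) m #(Ed H f ∪ Ed H g) ≤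
      Pr (n.choose 2) m e ^ 2 * (2 * (n.choose 2 : ℕ) / m : ℝ)^k := by
    rw [h1]
    refine (Pr_add_le _ _ _ _ hm).trans ?_
    rw [sq, mul_assoc]
    exact mul_le_mul_of_nonneg_left (Pr_sub_le _ _ _ _ hm hke he h0) hP
  refine h3.trans ?_
  apply mul_le_mul_of_nonneg_left _ (sq_nonneg _)
  have hkin : k ≤ eIn H (Sv f g : Set α) := inter_le H f g
  split_ifs with hS
  · have : k = 0 := by
      rw [hS] at hkin
      have : eIn H ((∅ : Finset α) : Set α) = 0 := by
        unfold eIn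
        rw [Set.ncard_eq_zero, Set.eq_empty_iff_forall_notMem]
        intro e
        induction e with
        | _ x y =>
          rintro ⟨_, h⟩
          simpa using h x (by simp)
      omega
    rw [this]; simp
  · have hd := eIn_le H (Sv f g) (nonempty_iff_ne_empty.2 hS)
    have hN : 2 * ((n.choose 2 : ℕ) : ℝ) ≤ (n:ℝ)^2 := by
      rw [Nat.cast_choose_two]
      nlinarith [Nat.cast_nonneg (α := ℝ) n]
    have hmN : (m:ℝ) ≤ (n.choose 2 : ℕ) := by exact_mod_cast hm
    have hr : 1 ≤ (n:ℝ)^2 / m := by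
      rw [le_div_iff₀ hmr]; linarith
    have h4 : (2 * (n.choose 2 : ℕ) / m : ℝ)^k ≤ (((n:ℝ)^2 / m) ^ maxDensity H) ^ #(Sv f g) := by
      calc _ ≤ ((n:ℝ)^2 / m)^k := by gcongr
        _ = ((n:ℝ)^2 / m)^(k:ℝ) := by rw [Real.rpow_natCast]
        _ ≤ ((n:ℝ)^2 / m)^(maxDensity H * #(Sv f g)) := by
          apply Real.rpow_le_rpow_of_exponent_le hr
          refine le_trans ?_ hd
          exact_mod_cast hkin
        _ = _ := by rw [Real.rpow_mul (by positivity), Real.rpow_natCast]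
    linarith

open Classical in
lemma second_moment {α : Type*} [Fintype α] [Nonempty α] (H : SimpleGraph α) {n m : ℕ}
    (hm : m ≤ n.choose 2) (he : 2 * H.edgeSet.ncard ≤ m) (h0 : 0 < m)
    (hn : 2 * Fintype.card α ≤ n) (y : ℝ) (hy : 0 ≤ y) (hy1 : y ≤ 1)
    (hq : ((n:ℝ)^2 / m) ^ maxDensity H = n * y) :
    1 ≤ containsProb H n m * (1 + (4 * Fintype.card α : ℝ)^(Fintype.card α) * y) := by
  set v := Fintype.card α with hv
  set N := n.choose 2 with hN
  set e := H.edgeSet.ncard with hee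
  set C : ℝ := (N.choose m : ℝ) with hC
  set P := Pr N m e with hP
  set F : ℝ := (Fintype.card (α ↪ Fin n) : ℝ) with hF
  set 𝓔 := powersetCard m (Om n) with hE
  set T := {E ∈ 𝓔 | ∃ f : α ↪ Fin n, Ed H f ⊆ E} with hT
  have hCpos : 0 < C := by
    rw [hC]; exact_mod_cast Nat.choose_pos hm
  have hPpos : 0 < P := Pr_pos _ _ _ hm (by omega)
  have hFge : ((n:ℝ)/2)^v ≤ F := by
    rw [hF, Fintype.card_embedding_eq, Fintype.card_fin]
    have h1 := Nat.pow_sub_le_descFactorial n v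
    have h2 : ((n + 1 - v : ℕ):ℝ)^v ≤ (n.descFactorial v : ℝ) := by exact_mod_cast h1
    refine le_trans ?_ h2
    gcongr
    rw [div_le_iff₀ (by norm_num)]
    have : n ≤ (n + 1 - v) * 2 := by omega
    exact_mod_cast this
  have hvpos : 0 < v := Fintype.card_pos
  have hnpos : (0:ℝ) < n := by exact_mod_cast (by omega : 0 < n)
  have hFpos : 0 < F := lt_of_lt_of_le (by positivity) hFge
  let X : Finset (Sym2 (Fin n)) → ℝ := fun E => ∑ f : α ↪ Fin n, if Ed H f ⊆ E then 1 else 0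
  have hX1 : ∑ E ∈ 𝓔, X E = F * (P * C) := by
    simp only [X]
    rw [sum_comm]
    have : ∀ f ∈ (univ : Finset (α ↪ Fin n)), (∑ E ∈ 𝓔, if Ed H f ⊆ E then (1:ℝ) else 0) = P * C := by
      intro f _
      rw [← sum_filter, sum_const, nsmul_eq_mul, mul_one,
        card_superset _ _ _ (Ed_sub_Om H f) (by rwa [card_Om]), card_Om, card_Ed]
    rw [sum_congr rfl this, sum_const, nsmul_eq_mul, card_univ]
  have hXT : ∑ E ∈ T, X E = ∑ E ∈ 𝓔, X E := by
    apply sum_subset (filter_subset _ _)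
    intro E hE1 hE2
    apply sum_eq_zero
    intro f _
    rw [if_neg]
    intro h
    exact hE2 (mem_filter.2 ⟨hE1, f, h⟩)
  have hX2 : ∑ E ∈ T, X E ^ 2 ≤ ∑ E ∈ 𝓔, X E ^ 2 :=
    sum_le_sum_of_subset_of_nonneg (filter_subset _ _) (fun _ _ _ => sq_nonneg _)
  have hX3 : ∑ E ∈ 𝓔, X E ^ 2 = ∑ f : α ↪ Fin n, ∑ g : α ↪ Fin n,
      Pr N m #(Ed H f ∪ Ed H g) * C := by
    have : ∀ E ∈ 𝓔, X E ^ 2 = ∑ f : α ↪ Fin n, ∑ g : α ↪ Fin n,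
        if Ed H f ∪ Ed H g ⊆ E then (1:ℝ) else 0 := by
      intro E _
      simp only [X]
      rw [sq, sum_mul_sum]
      refine sum_congr rfl fun f _ => sum_congr rfl fun g _ => ?_
      simp only [union_subset_iff, ite_and]
      split_ifs <;> simp
    rw [sum_congr rfl this, sum_comm]
    refine sum_congr rfl fun f _ => ?_
    rw [sum_comm]
    refine sum_congr rfl fun g _ => ?_
    rw [← sum_filter, sum_const, nsmul_eq_mul, mul_one,
        card_superset _ _ _ (union_subset (Ed_sub_Om H f) (Ed_sub_Om H g)) (by rwa [card_Om]),
        card_Om]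
  set ε := (4 * v : ℝ)^v * y with hε
  have hX4 : ∀ f ∈ (univ : Finset (α ↪ Fin n)), ∑ g : α ↪ Fin n,
      Pr N m #(Ed H f ∪ Ed H g) * C ≤ P ^ 2 * C * (F * (1 + ε)) := by
    intro f _
    calc _ ≤ ∑ g : α ↪ Fin n, P ^ 2 * (1 + if Sv f g = ∅ then 0 else
          (((n:ℝ)^2 / m) ^ maxDensity H) ^ #(Sv f g)) * C := by
          apply sum_le_sum
          intro g _
          apply mul_le_mul_of_nonneg_right _ hCpos.le
          exact pair_bound H f g hm he h0
      _ = P ^ 2 * C * (F + ∑ g : α ↪ Fin n, if Sv f g = ∅ then 0 else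
          (((n:ℝ)^2 / m) ^ maxDensity H) ^ #(Sv f g)) := by
          rw [← sum_mul, ← mul_sum, sum_add_distrib, sum_const, nsmul_eq_mul, card_univ]
          ring
      _ ≤ P ^ 2 * C * (F + 2^v * ((v:ℝ)^v * (n:ℝ)^v * y)) := by
          gcongr
          exact fiber_sum f _ y hy hy1 hq
      _ ≤ P ^ 2 * C * (F * (1 + ε)) := by
          apply mul_le_mul_of_nonneg_left _ (by positivity)
          rw [mul_add, mul_one]
          apply add_le_add le_rfl
          rw [hε]
          calc _ = (4 * v : ℝ)^v * y * ((n:ℝ)/2)^v := by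
                rw [mul_pow, div_pow, show (4:ℝ) = 2 * 2 by norm_num, mul_pow]
                field_simp
            _ ≤ (4 * v : ℝ)^v * y * F := by gcongr
            _ = _ := by ring
  have hX5 : ∑ E ∈ 𝓔, X E ^ 2 ≤ F * (P ^ 2 * C * (F * (1 + ε))) := by
    rw [hX3]
    refine (sum_le_card_nsmul _ _ _ hX4).trans ?_
    rw [nsmul_eq_mul, card_univ]
  have hCS := sq_sum_le_card_mul_sum_sq (s := T) (f := X)
  rw [hXT, hX1] at hCS
  have h6 : (F * (P * C))^2 ≤ #T * (F * (P ^ 2 * C * (F * (1 + ε)))) :=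
    hCS.trans (mul_le_mul_of_nonneg_left (hX2.trans hX5) (Nat.cast_nonneg _))
  rw [prob_eq]
  change 1 ≤ (#T : ℝ) / C * (1 + ε)
  rw [div_mul_eq_mul_div, le_div_iff₀ hCpos, one_mul]
  have h7 : 0 < F^2 * P^2 * C := by positivity
  apply le_of_mul_le_mul_left _ h7
  nlinarith

lemma prob_le_one {α : Type*} [Fintype α] (H : SimpleGraph α) (n m : ℕ) :
    containsProb H n m ≤ 1 := by
  classical
  rw [prob_eq]
  apply div_le_one_of_le₀ _ (Nat.cast_nonneg _)
  rw [← card_Om, ← card_powersetCard]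
  exact_mod_cast card_filter_le _ _

lemma prob_nonneg {α : Type*} [Fintype α] (H : SimpleGraph α) (n m : ℕ) :
    0 ≤ containsProb H n m := by
  unfold containsProb; positivity

lemma prob_le_sub {α : Type*} [Fintype α] [DecidableEq α] (H : SimpleGraph α) (H' : H.Subgraph)
    (n m : ℕ) (hm : m ≤ n.choose 2) :
    containsProb H n m ≤ (n:ℝ)^(H'.verts.ncard) *
      ((m:ℝ)/(n.choose 2 : ℕ))^(H'.edgeSet.ncard) := by
  classical
  have h := first_moment H'.coe n m hm
  have e1 : H'.coe.edgeSet.ncard = H'.edgeSet.ncard := by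
    rw [← SimpleGraph.Subgraph.image_coe_edgeSet_coe]
    rw [Set.ncard_image_of_injective _ (Sym2.map.injective Subtype.val_injective)]
  have e2 : Fintype.card H'.verts = H'.verts.ncard := by
    rw [← Nat.card_eq_fintype_card, Nat.card_coe_set_eq]
  rw [e1, e2] at h
  have hC : (0:ℝ) < ((n.choose 2).choose m : ℝ) := by exact_mod_cast Nat.choose_pos hm
  rw [prob_eq, div_le_iff₀ hC]
  refine le_trans ?_ h
  apply Nat.cast_le.2
  apply card_le_card
  intro E hE
  simp only [mem_filter] at hE ⊢
  refine ⟨hE.1, ?_⟩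
  rw [← contains_iff]
  obtain ⟨f, hf⟩ := (contains_iff H E).2 hE.2
  exact ⟨f.comp H'.hom, hf.comp H'.hom_injective⟩

open Filter in
lemma zero_part {α : Type*} [Fintype α] [DecidableEq α]
    (H : SimpleGraph α) (hH : H.edgeSet.Nonempty)
    (m : ℕ → ℕ) (hm : ∀ n, m n ≤ n.choose 2)
    (h : Tendsto (fun n : ℕ => (m n : ℝ) / (n : ℝ) ^ ((2 : ℝ) - 1 / maxDensity H))
        atTop (nhds 0)) :
      Tendsto (fun n : ℕ => containsProb H n (m n)) atTop (nhds 0) := by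
  obtain ⟨H', hv, hd⟩ := dens_attained H hH
  have hhalf := dens_half H hH
  set v := H'.verts.ncard
  set e := H'.edgeSet.ncard
  have he : e ≠ 0 := by
    intro h0
    rw [hd, h0] at hhalf
    norm_num at hhalf
  have hlim : Tendsto (fun n : ℕ => (4:ℝ)^e * ((m n : ℝ) / (n : ℝ) ^ ((2 : ℝ) - 1 / maxDensity H))^e)
      atTop (nhds 0) := by
    have := (h.pow e).const_mul ((4:ℝ)^e)
    simpa [he] using this
  apply squeeze_zero' (Eventually.of_forall fun n => prob_nonneg H n (m n)) _ hlim
  filter_upwards [eventually_ge_atTop 2] with n hn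
  refine (prob_le_sub H H' n (m n) (hm n)).trans ?_
  change (n:ℝ)^v * _ ^ e ≤ _
  have hn' : (2:ℝ) ≤ n := by exact_mod_cast hn
  have hn0 : (0:ℝ) < n := by linarith
  have her : (e:ℝ) ≠ 0 := by exact_mod_cast he
  have hN : (n:ℝ)^2 / 4 ≤ (n.choose 2 : ℕ) := by
    rw [Nat.cast_choose_two]; nlinarith
  have hp : ((n : ℝ) ^ ((2 : ℝ) - 1 / maxDensity H))^e * (n:ℝ)^v = ((n:ℝ)^2)^e := by
    rw [← Real.rpow_natCast, ← Real.rpow_natCast, ← Real.rpow_natCast, ← Real.rpow_natCast,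
      ← Real.rpow_mul hn0.le, ← Real.rpow_mul hn0.le, ← Real.rpow_add hn0, hd]
    congr 1
    field_simp
    push_cast
    ring
  have hpos : 0 < (n : ℝ) ^ ((2 : ℝ) - 1 / maxDensity H) := Real.rpow_pos_of_pos hn0 _
  calc (n:ℝ)^v * ((m n:ℝ)/(n.choose 2 : ℕ))^e ≤ (n:ℝ)^v * ((m n:ℝ)/((n:ℝ)^2/4))^e := by gcongr
    _ = _ := by
      rw [div_pow, div_pow, div_pow, ← hp]
      field_simp

open Filter in
lemma one_part {α : Type*} [Fintype α] [DecidableEq α]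
    (H : SimpleGraph α) (hH : H.edgeSet.Nonempty)
    (m : ℕ → ℕ) (hm : ∀ n, m n ≤ n.choose 2)
    (h : Tendsto (fun n : ℕ => (m n : ℝ) / (n : ℝ) ^ ((2 : ℝ) - 1 / maxDensity H))
        atTop atTop) :
      Tendsto (fun n : ℕ => containsProb H n (m n)) atTop (nhds 1) := by
  have hhalf := dens_half H hH
  set d := maxDensity H with hdd
  have hd0 : 0 < d := by linarith
  have : Nonempty α := by
    obtain ⟨e, he⟩ := hH
    induction e with
    | _ x y => exact ⟨x⟩
  set y : ℕ → ℝ := fun n => ((m n : ℝ) / (n : ℝ) ^ ((2 : ℝ) - 1 / d)) ^ (-d) with hy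
  have hylim : Tendsto y atTop (nhds 0) := (tendsto_rpow_neg_atTop hd0).comp h
  set c : ℝ := (4 * Fintype.card α : ℝ)^(Fintype.card α) with hc
  have hlim : Tendsto (fun n => (1 + c * y n)⁻¹) atTop (nhds 1) := by
    have : Tendsto (fun n => 1 + c * y n) atTop (nhds (1 + c * 0)) :=
      (hylim.const_mul c).const_add 1
    have h2 := this.inv₀ (by norm_num)
    simpa using h2
  apply tendsto_of_tendsto_of_tendsto_of_le_of_le' hlim tendsto_const_nhds _
    (Eventually.of_forall fun n => prob_le_one H n (m n))
  filter_upwards [eventually_ge_atTop 1, eventually_ge_atTop (2 * Fintype.card α),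
    h.eventually_ge_atTop 1, h.eventually_ge_atTop ((2 * H.edgeSet.ncard : ℕ) : ℝ),
    hylim.eventually_le_const (by norm_num : (0:ℝ) < 1)] with n hn hnv hx1 hxe hy1
  have hn1 : (1:ℝ) ≤ n := by exact_mod_cast hn
  have hn0 : (0:ℝ) < n := by linarith
  have hexp : 0 ≤ (2:ℝ) - 1 / d := by
    have : 1 / d ≤ 2 := by
      rw [div_le_iff₀ hd0]; linarith
    linarith
  have hpos : 0 < (n : ℝ) ^ ((2 : ℝ) - 1 / d) := Real.rpow_pos_of_pos hn0 _
  have hxm : (m n : ℝ) / (n : ℝ) ^ ((2 : ℝ) - 1 / d) ≤ m n :=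
    div_le_self (Nat.cast_nonneg _) (Real.one_le_rpow hn1 hexp)
  have hm0 : 0 < m n := by
    have : (1:ℝ) ≤ m n := hx1.trans hxm
    exact_mod_cast this
  have hme : 2 * H.edgeSet.ncard ≤ m n := by exact_mod_cast hxe.trans hxm
  have hmr : (0:ℝ) < m n := by exact_mod_cast hm0
  have hy0 : 0 ≤ y n := by positivity
  have hq : ((n:ℝ)^2 / m n) ^ maxDensity H = n * y n := by
    rw [← hdd]
    simp only [hy]
    rw [Real.rpow_neg (by positivity), ← Real.inv_rpow (by positivity), inv_div,
      Real.div_rpow (by positivity) (by positivity), Real.div_rpow (by positivity) (by positivity),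
      ← Real.rpow_mul hn0.le, ← mul_div_assoc]
    congr 1
    have : (n:ℝ) * (n:ℝ) ^ ((2 - 1 / d) * d) = (n:ℝ) ^ (1 + (2 - 1 / d) * d) := by
      rw [Real.rpow_add hn0, Real.rpow_one]
    rw [this, ← Real.rpow_natCast, ← Real.rpow_mul hn0.le]
    congr 1
    field_simp
    push_cast
    ring
  have key := second_moment H (hm n) hme hm0 hnv (y n) hy0 hy1 hq
  have hpos2 : 0 < 1 + c * y n := by positivity
  rw [inv_eq_one_div, div_le_iff₀ hpos2]
  exact key

end SmallSub

open Filter GraphDefs in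
/-- Bollobás: `n^(2 − 1/m(H))` is a threshold for containing `H`
in `G(n, m)`. -/
theorem threshold_small_subgraphs {α : Type*} [Fintype α] [DecidableEq α]
    (H : SimpleGraph α) (hH : H.edgeSet.Nonempty)
    (m : ℕ → ℕ) (hm : ∀ n, m n ≤ n.choose 2) :
    (Tendsto (fun n : ℕ => (m n : ℝ) / (n : ℝ) ^ ((2 : ℝ) - 1 / maxDensity H))
        atTop atTop →
      Tendsto (fun n : ℕ => containsProb H n (m n)) atTop (nhds 1)) ∧
    (Tendsto (fun n : ℕ => (m n : ℝ) / (n : ℝ) ^ ((2 : ℝ) - 1 / maxDensity H))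
        atTop (nhds 0) →
      Tendsto (fun n : ℕ => containsProb H n (m n)) atTop (nhds 0)) := by
  exact ⟨SmallSub.one_part H hH m hm, SmallSub.zero_part H hH m hm⟩
end

section
/- For every integer k ≥ 2 and every k-uniform hypergraph H with at least one edge, there exist constants c > 0 and γ > 0 such that for all sufficiently large n and every integer b with 1 ≤ b ≤ c·n^{1/m(H)}, in the b-Waiter-Client game played on the set of all k-element subsets of an n-element vertex set, Waiter can ensure that Client's final k-uniform hypergraph G contains at least γ·n^{v(H)}/b^{e(H)} sub-hypergraphs isomorphic to H. -/
/-- The maximum density `m(H)` of a hypergraph with edge set `E` on the finite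
vertex type `α`: the maximum of `e(H')/v(H')` over all sub-hypergraphs
`H' = (V', E')` with at least one vertex. -/
noncomputable def hMaxDensity {α : Type*} [Fintype α] [DecidableEq α]
    (E : Finset (Finset α)) : ℝ :=
  sSup { d : ℝ | ∃ (V' : Finset α) (E' : Finset (Finset α)), E' ⊆ E ∧
          (∀ e ∈ E', e ⊆ V') ∧ V'.Nonempty ∧ d = (E'.card : ℝ) / (V'.card : ℝ) }

/-- The number of sub-hypergraphs of the hypergraph on `Fin n` with edge set `S`
which are isomorphic to the hypergraph on `α` with edge set `E`: pairs
`(V', E')` arising as the image of the vertices and edges under an injection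
`f : α ↪ Fin n` with all image edges in `S`. -/
noncomputable def hCopyCount {α : Type*} [Fintype α] [DecidableEq α]
    (E : Finset (Finset α)) {n : ℕ} (S : Finset (Finset (Fin n))) : ℕ :=
  Set.ncard { q : Finset (Fin n) × Finset (Finset (Fin n)) |
    ∃ f : α ↪ Fin n, q.1 = Finset.univ.map f ∧
      q.2 = E.image (fun e => e.map f) ∧ q.2 ⊆ S }

open WCGame in
inductive Wins {X : Type*} [DecidableEq X] (board : Finset X) (b : ℕ)
    (P : Finset X → Finset X → Prop) : Finset X → Finset X → Prop
  | fin (O S : Finset X) (h : P O S) : Wins board b P O S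
  | step (O S B : Finset X) (hc : B.card = b) (hB : B ⊆ board) (hd : Disjoint B O)
      (h : ∀ x ∈ B, Wins board b P (O ∪ B) (insert x S)) : Wins board b P O S

theorem Wins.bind {X : Type*} [DecidableEq X] {board : Finset X} {b : ℕ}
    {Q P : Finset X → Finset X → Prop} {O S : Finset X} (h : Wins board b Q O S)
    (hQ : ∀ O S, Q O S → Wins board b P O S) : Wins board b P O S := by
  induction h with
  | fin O S h => exact hQ O S h
  | step O S B hc hB hd h ih => exact Wins.step O S B hc hB hd ih

section conv
open WCGame

def pickedSet {X : Type*} [DecidableEq X] (h : Hist X) : Finset X := (h.map Prod.snd).toFinset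

theorem offeredSet_append {X : Type*} [DecidableEq X] (h : Hist X) (B : Finset X) (x : X) :
    offeredSet (h ++ [(B, x)]) = offeredSet h ∪ B := by
  induction h with
  | nil => simp [offeredSet]
  | cons a t ih =>
    simp only [offeredSet, List.cons_append, List.foldr_cons] at ih ⊢
    rw [ih, Finset.union_assoc]

theorem pickedSet_append {X : Type*} [DecidableEq X] (h : Hist X) (B : Finset X) (x : X) :
    pickedSet (h ++ [(B, x)]) = insert x (pickedSet h) := by
  ext y; simp [pickedSet]

def Mv {X : Type*} [DecidableEq X] (board : Finset X) (b : ℕ)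
    (P : Finset X → Finset X → Prop) (O S B : Finset X) : Prop :=
  B.card = b ∧ B ⊆ board ∧ Disjoint B O ∧ ∀ x ∈ B, Wins board b P (O ∪ B) (insert x S)

open Classical in
noncomputable def strat {X : Type*} [DecidableEq X] (board : Finset X) (b : ℕ)
    (P : Finset X → Finset X → Prop) : WaiterStrategy X := fun h =>
  if P (offeredSet h) (pickedSet h) then none
  else if hB : ∃ B, Mv board b P (offeredSet h) (pickedSet h) B then some hB.choose else none

theorem play_wins {X : Type*} [DecidableEq X] (board : Finset X) (b : ℕ) (hb : 1 ≤ b)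
    (P : Finset X → Finset X → Prop) (C : ClientStrategy X) (hC : ClientLegal C) (fuel : ℕ) :
    ∀ h : Hist X, offeredSet h ⊆ board → board.card ≤ (offeredSet h).card + fuel →
      Wins board b P (offeredSet h) (pickedSet h) →
      ∃ O, P O (pickedSet (playAux (strat board b P) C fuel h)) := by
  induction fuel with
  | zero =>
    intro h hs hc hw
    have he : offeredSet h = board := Finset.eq_of_subset_of_card_le hs (by simpa using hc)
    cases hw with
    | fin _ _ h => exact ⟨_, h⟩
    | step _ _ B hc' hB hd h' =>
      rw [he] at hd
      have : B = ∅ := by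
        have := hd.mono_right hB
        simpa using this
      simp [this] at hc'; omega
  | succ m ih =>
    intro h hs hc hw
    by_cases hP : P (offeredSet h) (pickedSet h)
    · refine ⟨offeredSet h, ?_⟩
      have : strat board b P h = none := by simp [strat, hP]
      simpa [playAux, this] using hP
    · have hB : ∃ B, Mv board b P (offeredSet h) (pickedSet h) B := by
        cases hw with
        | fin _ _ h => exact absurd h hP
        | step _ _ B hc' hB hd h' => exact ⟨B, hc', hB, hd, h'⟩
      have hst : strat board b P h = some hB.choose := by simp [strat, hP, hB]
      obtain ⟨h1, h2, h3, h4⟩ := hB.choose_spec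
      set B := hB.choose
      have hne : B.Nonempty := by rw [← Finset.card_pos]; omega
      simp only [playAux, hst]
      apply ih
      · rw [offeredSet_append]; exact Finset.union_subset hs h2
      · rw [offeredSet_append, Finset.card_union_of_disjoint h3.symm]; omega
      · rw [offeredSet_append, pickedSet_append]; exact h4 _ (hC h B hne)

theorem Wins.ensure {X : Type*} [DecidableEq X] {board : Finset X} {b : ℕ} (hb : 1 ≤ b)
    {P : Finset X → Finset X → Prop} (Q : Finset X → Prop) (h : Wins board b P ∅ ∅)
    (hPQ : ∀ O S, P O S → Q S) : WaiterCanEnsure board b Q := by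
  refine ⟨strat board b P, ?_, ?_⟩
  · intro h O hO
    unfold strat at hO
    split_ifs at hO with h1 h2
    obtain ⟨a1, a2, a3, -⟩ := h2.choose_spec
    have := Option.some.inj hO
    rw [this] at a1 a2 a3
    exact ⟨a1, a2, a3⟩
  · intro C hC
    obtain ⟨O, hO⟩ := play_wins board b hb P C hC board.card [] (by simp [offeredSet])
      (by simp) (by simpa [offeredSet, pickedSet] using h)
    exact hPQ O _ hO

end conv

theorem exists_top {X : Type*} [DecidableEq X] (D : X → ℝ) (s : Finset X) (b : ℕ)
    (hb : b ≤ s.card) :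
    ∃ B ⊆ s, B.card = b ∧ ∀ x ∈ B, ∀ y ∈ s \ B, D y ≤ D x := by
  induction b with
  | zero => exact ⟨∅, by simp, by simp, by simp⟩
  | succ m ih =>
    obtain ⟨B, hB, hc, h⟩ := ih (by omega)
    have hne : (s \ B).Nonempty := by
      rw [← Finset.card_pos, Finset.card_sdiff_of_subset hB]; omega
    obtain ⟨z, hz, hmax⟩ := Finset.exists_max_image (s \ B) D hne
    have hz' := Finset.mem_sdiff.1 hz
    refine ⟨insert z B, ?_, ?_, ?_⟩
    · exact Finset.insert_subset hz'.1 hB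
    · rw [Finset.card_insert_of_notMem hz'.2, hc]
    · intro x hx y hy
      simp only [Finset.mem_sdiff, Finset.mem_insert, not_or] at hy
      have hy' : y ∈ s \ B := Finset.mem_sdiff.2 ⟨hy.1, hy.2.2⟩
      rcases Finset.mem_insert.1 hx with rfl | hx
      · exact hmax y hy'
      · exact h x hx y hy'

theorem exists_top' {X : Type*} [DecidableEq X] (D : X → ℝ) (s : Finset X) (b : ℕ) (hb1 : 1 ≤ b)
    (hb : b ≤ s.card) (hD : ∀ x, 0 ≤ D x) :
    ∃ B ⊆ s, B.card = b ∧ ∃ t : ℝ, 0 ≤ t ∧ (∀ x ∈ B, t ≤ D x) ∧ ∀ y ∈ s \ B, D y ≤ t := by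
  obtain ⟨B, hB, hc, h⟩ := exists_top D s b hb
  have hne : B.Nonempty := by rw [← Finset.card_pos]; omega
  obtain ⟨z, hz, hmin⟩ := Finset.exists_min_image B D hne
  exact ⟨B, hB, hc, D z, hD z, hmin, h z hz⟩

/-- goodness of an element with respect to the already picked set `T`. -/
def Good {X : Type*} [DecidableEq X] {ι : Type*} (R : Finset X) (b : ℕ) (D : X → ℝ) (A C : ℝ)
    (q : ι → X → X → ℝ) (U : ι → ℝ) (T : Finset X) (r : X) : Prop :=
  D r * (8 * b) ≤ A ∧ (∀ j, (∑ y ∈ R, q j r y) * A ≤ C * U j * D r) ∧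
    ∀ j, (∑ y ∈ T, q j r y) * (A * (2 * b)) ≤ C ^ 2 * U j * D r

theorem bad_mass {X : Type*} [DecidableEq X] {ι : Type*} [Fintype ι] (R : Finset X) (b : ℕ)
    (hb : 1 ≤ b) (D : X → ℝ) (hD : ∀ x, 0 ≤ D x) (A C : ℝ) (hA : 0 < A) (hC : 0 < C)
    (hCι : 8 * (Fintype.card ι : ℝ) ≤ C)
    (hD2 : ∑ x ∈ R, D x ^ 2 ≤ A ^ 2 / (64 * b))
    (q : ι → X → X → ℝ) (hq : ∀ j x y, 0 ≤ q j x y) (hqs : ∀ j x y, q j x y = q j y x)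
    (U : ι → ℝ) (hU : ∀ j, 0 < U j) (hqU : ∀ j, ∑ x ∈ R, ∑ y ∈ R, q j x y ≤ U j)
    (T Bd : Finset X) (hBd : Bd ⊆ R)
    (hT2 : ∀ j, (∑ x ∈ T, ∑ y ∈ R, q j x y) * (2 * b) ≤ C * U j)
    (hbad : ∀ x ∈ Bd, ¬ Good R b D A C q U T x) :
    ∑ x ∈ Bd, D x ≤ 3 / 8 * A := by
  have hb0 : (0 : ℝ) < b := by exact_mod_cast hb
  set g : X → ℝ := fun r => D r ^ 2 * (8 * b) / A +
    ∑ j, ((∑ y ∈ R, q j r y) * A / (C * U j) +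
      (∑ y ∈ T, q j r y) * (A * (2 * b)) / (C ^ 2 * U j)) with hg
  have n1 : ∀ r, 0 ≤ D r ^ 2 * (8 * b) / A := fun r => by positivity
  have n2 : ∀ r j, 0 ≤ (∑ y ∈ R, q j r y) * A / (C * U j) := fun r j =>
    div_nonneg (mul_nonneg (Finset.sum_nonneg fun _ _ => hq _ _ _) hA.le)
      (mul_pos hC (hU j)).le
  have n3 : ∀ r j, 0 ≤ (∑ y ∈ T, q j r y) * (A * (2 * b)) / (C ^ 2 * U j) := fun r j =>
    div_nonneg (mul_nonneg (Finset.sum_nonneg fun _ _ => hq _ _ _) (by positivity))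
      (mul_pos (by positivity) (hU j)).le
  have g0 : ∀ r, 0 ≤ g r := fun r =>
    add_nonneg (n1 r) (Finset.sum_nonneg fun j _ => add_nonneg (n2 r j) (n3 r j))
  have hpt : ∀ x ∈ Bd, D x ≤ g x := by
    intro x hx
    have hx' := hbad x hx
    have hsum : ∀ j, (∑ y ∈ R, q j x y) * A / (C * U j) +
      (∑ y ∈ T, q j x y) * (A * (2 * b)) / (C ^ 2 * U j) ≤ g x := by
      intro j
      have := Finset.single_le_sum (f := fun j => (∑ y ∈ R, q j x y) * A / (C * U j) +
        (∑ y ∈ T, q j x y) * (A * (2 * b)) / (C ^ 2 * U j))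
        (fun j _ => add_nonneg (n2 x j) (n3 x j)) (Finset.mem_univ j)
      simp only [hg]
      have := n1 x
      linarith
    unfold Good at hx'
    by_cases c1 : D x * (8 * b) ≤ A
    · by_cases c2 : ∀ j, (∑ y ∈ R, q j x y) * A ≤ C * U j * D x
      · have c3 : ¬ ∀ j, (∑ y ∈ T, q j x y) * (A * (2 * b)) ≤ C ^ 2 * U j * D x :=
          fun c3 => hx' ⟨c1, c2, c3⟩
        push Not at c3
        obtain ⟨j, hj⟩ := c3
        have h1 : D x ≤ (∑ y ∈ T, q j x y) * (A * (2 * b)) / (C ^ 2 * U j) := by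
          rw [le_div_iff₀ (mul_pos (by positivity) (hU j))]; linarith
        linarith [hsum j, n2 x j]
      · push Not at c2
        obtain ⟨j, hj⟩ := c2
        have h1 : D x ≤ (∑ y ∈ R, q j x y) * A / (C * U j) := by
          rw [le_div_iff₀ (mul_pos hC (hU j))]; linarith
        linarith [hsum j, n3 x j]
    · push Not at c1
      have h1 : D x ≤ D x ^ 2 * (8 * b) / A := by
        rw [le_div_iff₀ hA]; nlinarith [hD x]
      have h2 : 0 ≤ ∑ j, ((∑ y ∈ R, q j x y) * A / (C * U j) +
        (∑ y ∈ T, q j x y) * (A * (2 * b)) / (C ^ 2 * U j)) :=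
        Finset.sum_nonneg fun j _ => add_nonneg (n2 x j) (n3 x j)
      simp only [hg]
      linarith
  have hsumg : ∑ x ∈ R, g x ≤ 3 / 8 * A := by
    simp only [hg]
    rw [Finset.sum_add_distrib, Finset.sum_comm]
    have e1 : ∑ x ∈ R, D x ^ 2 * (8 * b) / A ≤ A / 8 := by
      rw [← Finset.sum_div, ← Finset.sum_mul, div_le_iff₀ hA]
      rw [le_div_iff₀ (by positivity)] at hD2
      nlinarith
    have e2 : ∀ j, ∑ x ∈ R, ((∑ y ∈ R, q j x y) * A / (C * U j) +
        (∑ y ∈ T, q j x y) * (A * (2 * b)) / (C ^ 2 * U j)) ≤ 2 * A / C := by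
      intro j
      have hUj := hU j
      rw [Finset.sum_add_distrib, ← Finset.sum_div, ← Finset.sum_mul, ← Finset.sum_div,
        ← Finset.sum_mul]
      have f1 : (∑ x ∈ R, ∑ y ∈ R, q j x y) * A / (C * U j) ≤ A / C := by
        rw [div_le_div_iff₀ (by positivity) hC]
        have := mul_le_mul_of_nonneg_right (hqU j) (by positivity : 0 ≤ A * C)
        nlinarith
      have f2 : (∑ x ∈ R, ∑ y ∈ T, q j x y) * (A * (2 * b)) / (C ^ 2 * U j) ≤ A / C := by
        rw [div_le_div_iff₀ (by positivity) hC]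
        have : ∑ x ∈ R, ∑ y ∈ T, q j x y = ∑ x ∈ T, ∑ y ∈ R, q j x y := by
          rw [Finset.sum_comm]
          exact Finset.sum_congr rfl fun x _ => Finset.sum_congr rfl fun y _ => hqs _ _ _
        rw [this]
        have := mul_le_mul_of_nonneg_right (hT2 j) (by positivity : 0 ≤ A * C)
        nlinarith
      have : 2 * A / C = A / C + A / C := by ring
      linarith
    have e3 : ∑ j, ∑ x ∈ R, ((∑ y ∈ R, q j x y) * A / (C * U j) +
        (∑ y ∈ T, q j x y) * (A * (2 * b)) / (C ^ 2 * U j)) ≤ A / 4 := by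
      calc _ ≤ ∑ j : ι, 2 * A / C := Finset.sum_le_sum fun j _ => e2 j
        _ = Fintype.card ι * (2 * A / C) := by simp
        _ ≤ A / 4 := by
          rw [← mul_div_assoc, div_le_iff₀ hC]; nlinarith
    linarith
  calc ∑ x ∈ Bd, D x ≤ ∑ x ∈ Bd, g x := Finset.sum_le_sum hpt
    _ ≤ ∑ x ∈ R, g x := Finset.sum_le_sum_of_subset_of_nonneg hBd fun x _ _ => g0 x
    _ ≤ _ := hsumg

def offd {X : Type*} [DecidableEq X] (q : X → X → ℝ) (T : Finset X) : ℝ :=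
  ∑ x ∈ T, ∑ y ∈ T, if x = y then 0 else q x y

theorem offd_insert {X : Type*} [DecidableEq X] (q : X → X → ℝ) (hq : ∀ x y, q x y = q y x)
    (T : Finset X) (x : X) (hx : x ∉ T) :
    offd q (insert x T) = offd q T + 2 * ∑ y ∈ T, q x y := by
  unfold offd
  rw [Finset.sum_insert hx, Finset.sum_insert hx]
  simp only [Finset.sum_insert hx, if_true]
  rw [Finset.sum_add_distrib]
  have h1 : ∑ y ∈ T, (if x = y then 0 else q x y) = ∑ y ∈ T, q x y :=
    Finset.sum_congr rfl fun y hy => if_neg (by rintro rfl; exact hx hy)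
  have h2 : ∑ y ∈ T, (if y = x then 0 else q y x) = ∑ y ∈ T, q x y :=
    Finset.sum_congr rfl fun y hy => by
      rw [if_neg (by rintro rfl; exact hx hy), hq]
  rw [h1, h2]; ring

def StageEnd {X : Type*} [DecidableEq X] {ι : Type*} (R O0 S0 : Finset X) (b : ℕ)
    (D : X → ℝ) (A C : ℝ) (q : ι → X → X → ℝ) (U : ι → ℝ) (O S : Finset X) : Prop :=
  O ⊆ O0 ∪ R ∧ ∃ T ⊆ R, S = S0 ∪ T ∧ A / (4 * b) ≤ ∑ x ∈ T, D x ∧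
    (∀ j, (∑ x ∈ T, ∑ y ∈ R, q j x y) * (2 * b) ≤ C * U j) ∧
    ∀ j, offd (q j) T * (2 * b ^ 2) ≤ C ^ 2 * U j

theorem stage {X : Type*} [DecidableEq X] {ι : Type*} [Fintype ι] (board R O0 S0 : Finset X)
    (b : ℕ) (hb : 1 ≤ b) (hR : R ⊆ board) (hRO : Disjoint R O0)
    (D : X → ℝ) (hD : ∀ x, 0 ≤ D x) (A C : ℝ) (hA : 0 < A) (hAD : A = ∑ x ∈ R, D x)
    (hC : 0 < C) (hCι : 8 * (Fintype.card ι : ℝ) ≤ C)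
    (hD2 : ∑ x ∈ R, D x ^ 2 ≤ A ^ 2 / (64 * b))
    (q : ι → X → X → ℝ) (hq : ∀ j x y, 0 ≤ q j x y) (hqs : ∀ j x y, q j x y = q j y x)
    (U : ι → ℝ) (hU : ∀ j, 0 < U j) (hqU : ∀ j, ∑ x ∈ R, ∑ y ∈ R, q j x y ≤ U j) :
    Wins board b (StageEnd R O0 S0 b D A C q U) O0 S0 := by
  classical
  have hb0 : (0 : ℝ) < b := by exact_mod_cast hb
  have key : ∀ m : ℕ, ∀ Q T : Finset X, (R \ Q).card < m → T ⊆ Q → Q ⊆ R →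
      (∑ x ∈ T, D x) * (2 * b) ≤ A →
      (∀ j, (∑ x ∈ T, ∑ y ∈ R, q j x y) * A ≤ C * U j * ∑ x ∈ T, D x) →
      (∀ j, offd (q j) T * (A * b) ≤ C ^ 2 * U j * ∑ x ∈ T, D x) →
      (∃ t : ℝ, 0 ≤ t ∧ (∀ r ∈ R \ Q, Good R b D A C q U T r → D r ≤ t) ∧
        ∑ x ∈ Q, D x ≤ A / 8 + b * (∑ x ∈ T, D x - t)) →
      Wins board b (StageEnd R O0 S0 b D A C q U) (O0 ∪ Q) (S0 ∪ T) := by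
    intro m
    induction m with
    | zero => intro Q T hm; omega
    | succ m ih =>
      intro Q T hm hTQ hQR h1 h2 h3 ⟨t, ht0, ht, hmass⟩
      have hT2 : ∀ j, (∑ x ∈ T, ∑ y ∈ R, q j x y) * (2 * b) ≤ C * U j := by
        intro j
        have e1 := mul_le_mul_of_nonneg_right (h2 j) (by positivity : (0:ℝ) ≤ 2 * b)
        have e2 := mul_le_mul_of_nonneg_left h1 (mul_pos hC (hU j)).le
        exact le_of_mul_le_mul_right (by linarith) hA
      by_cases hfin : A / (4 * b) ≤ ∑ x ∈ T, D x
      · refine Wins.fin _ _ ⟨Finset.union_subset_union_right hQR, T, hTQ.trans hQR, rfl, hfin,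
          hT2, fun j => ?_⟩
        have e1 := mul_le_mul_of_nonneg_right (h3 j) (by positivity : (0:ℝ) ≤ 2 * b)
        have e2 := mul_le_mul_of_nonneg_left h1 (mul_pos (pow_pos hC 2) (hU j)).le
        exact le_of_mul_le_mul_right (by linarith) hA
      · push Not at hfin
        rw [lt_div_iff₀ (by positivity)] at hfin
        set G := (R \ Q).filter (fun r => Good R b D A C q U T r) with hG
        have hGs : G ⊆ R \ Q := Finset.filter_subset _ _
        have hGt : ∀ r ∈ G, D r ≤ t := fun r hr =>
          ht r (hGs hr) (Finset.mem_filter.1 hr).2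
        have hGb : b ≤ G.card := by
          by_contra hlt
          push Not at hlt
          have s1 : ∑ x ∈ G, D x ≤ b * t := by
            calc ∑ x ∈ G, D x ≤ ∑ x ∈ G, t := Finset.sum_le_sum hGt
              _ = G.card * t := by simp
              _ ≤ b * t := by gcongr
          have s2 := bad_mass R b hb D hD A C hA hC hCι hD2 q hq hqs U hU hqU T ((R \ Q) \ G)
            (Finset.sdiff_subset.trans Finset.sdiff_subset) hT2 (by
              intro x hx hgood
              rw [Finset.mem_sdiff] at hx
              exact hx.2 (Finset.mem_filter.2 ⟨hx.1, hgood⟩))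
          have s3 := Finset.sum_sdiff (f := D) hQR
          have s4 := Finset.sum_sdiff (f := D) hGs
          nlinarith
        obtain ⟨B, hBG, hBc, t', ht'0, ht'B, ht'r⟩ := exists_top' D G b hb hGb hD
        have hBR : B ⊆ R \ Q := hBG.trans hGs
        have hBQ : Disjoint Q B :=
          Finset.disjoint_left.2 fun x hx hx' => (Finset.mem_sdiff.1 (hBR hx')).2 hx
        refine Wins.step _ _ B hBc ((hBR.trans Finset.sdiff_subset).trans hR) ?_ ?_
        · rw [Finset.disjoint_union_right]
          exact ⟨hRO.mono_left (hBR.trans Finset.sdiff_subset), hBQ.symm⟩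
        · intro x hx
          rw [Finset.union_assoc, ← Finset.union_insert]
          have hxG := (Finset.mem_filter.1 (hBG hx)).2
          have hxT : x ∉ T := fun h => (Finset.mem_sdiff.1 (hBR hx)).2 (hTQ h)
          apply ih (Q ∪ B) (insert x T)
          · have : R \ (Q ∪ B) ⊂ R \ Q := by
              refine (Finset.ssubset_iff_of_subset
                (Finset.sdiff_subset_sdiff le_rfl Finset.subset_union_left)).2 ⟨x, hBR hx, ?_⟩
              simp [hx]
            have := Finset.card_lt_card this
            omega
          · exact Finset.insert_subset (Finset.mem_union_right _ hx)
              (hTQ.trans Finset.subset_union_left)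
          · exact Finset.union_subset hQR (hBR.trans Finset.sdiff_subset)
          · rw [Finset.sum_insert hxT]
            have := hxG.1
            have := hD x
            nlinarith
          · intro j
            rw [Finset.sum_insert hxT, Finset.sum_insert hxT]
            have := hxG.2.1 j
            have := h2 j
            nlinarith
          · intro j
            rw [Finset.sum_insert hxT, offd_insert _ (hqs j) _ _ hxT]
            have := hxG.2.2 j
            have := h3 j
            nlinarith
          · refine ⟨t', ht'0, ?_, ?_⟩
            · intro r hr hgood
              have hr' : r ∈ R \ Q ∧ r ∉ B := by
                simp only [Finset.mem_sdiff, Finset.mem_union, not_or] at hr ⊢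
                tauto
              apply ht'r
              refine Finset.mem_sdiff.2 ⟨Finset.mem_filter.2 ⟨hr'.1, hgood.1, hgood.2.1, ?_⟩, hr'.2⟩
              intro j
              refine le_trans ?_ (hgood.2.2 j)
              rw [Finset.sum_insert hxT]
              have := hq j r x
              gcongr
              linarith
            · rw [Finset.sum_union hBQ, Finset.sum_insert hxT]
              have s1 : ∑ x ∈ B, D x ≤ b * t := by
                calc ∑ x ∈ B, D x ≤ ∑ x ∈ B, t := Finset.sum_le_sum fun y hy => hGt y (hBG hy)
                  _ = B.card * t := by simp
                  _ = b * t := by rw [hBc]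
              have := mul_le_mul_of_nonneg_left (ht'B x hx) hb0.le
              linarith
  have := key _ ∅ ∅ (Nat.lt_succ_self _) (by simp) (by simp) (by simpa using hA.le) (by simp)
    (by simp [offd]) ⟨A / (8 * b), by positivity, ?_, ?_⟩
  · simpa using this
  · intro r _ hr
    rw [le_div_iff₀ (by positivity)]; exact hr.1
  · simp; field_simp; norm_num

section hyper

variable {α : Type*} [Fintype α] [DecidableEq α] {N n : ℕ}

/-- the image of an edge under the canonical map. -/
def edg (φ : α × Fin N ↪ Fin n) (e : Finset α) (f : α → Fin N) : Finset (Fin n) :=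
  e.image (fun a => φ (a, f a))

theorem mem_edg (φ : α × Fin N ↪ Fin n) (e : Finset α) (f : α → Fin N) (a : α) (i : Fin N) :
    φ (a, i) ∈ edg φ e f ↔ a ∈ e ∧ f a = i := by
  simp only [edg, Finset.mem_image, φ.injective.eq_iff, Prod.mk.injEq]
  constructor
  · rintro ⟨c, hc, rfl, h⟩; exact ⟨hc, h⟩
  · rintro ⟨h, h'⟩; exact ⟨a, h, rfl, h'⟩

theorem edg_sub (φ : α × Fin N ↪ Fin n) {e e' : Finset α} {f f' : α → Fin N}
    (h : edg φ e f = edg φ e' f') : ∀ a ∈ e, a ∈ e' ∧ f' a = f a := by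
  intro a ha
  have : φ (a, f a) ∈ edg φ e f := (mem_edg φ e f a _).2 ⟨ha, rfl⟩
  rw [h] at this
  exact (mem_edg φ e' f' a _).1 this

theorem edg_eq (φ : α × Fin N ↪ Fin n) {e e' : Finset α} {f f' : α → Fin N}
    (h : edg φ e f = edg φ e' f') : e = e' :=
  Finset.Subset.antisymm (fun a ha => (edg_sub φ h a ha).1)
    (fun a ha => (edg_sub φ h.symm a ha).1)

theorem edg_iff (φ : α × Fin N ↪ Fin n) {e : Finset α} {f f' : α → Fin N} :
    edg φ e f = edg φ e f' ↔ ∀ a ∈ e, f a = f' a := by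
  constructor
  · intro h a ha; exact (edg_sub φ h a ha).2.symm
  · intro h
    exact Finset.image_congr fun a ha => by
      simp only [h a ha]

theorem edg_card (φ : α × Fin N ↪ Fin n) (e : Finset α) (f : α → Fin N) :
    (edg φ e f).card = e.card := by
  refine Finset.card_image_of_injective _ fun a b h => ?_
  exact congrArg Prod.fst (φ.injective h)

def cop (φ : α × Fin N ↪ Fin n) (P : Finset (Finset α)) (S : Finset (Finset (Fin n))) :
    Finset (α → Fin N) :=
  Finset.univ.filter (fun f => ∀ e ∈ P, edg φ e f ∈ S)

noncomputable def MM (F : Finset (α → Fin N)) (J : Finset α) : ℝ :=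
  ((F ×ˢ F).filter (fun p => ∀ a ∈ J, p.1 a = p.2 a)).card

noncomputable def beta (b N : ℕ) (P : Finset (Finset α)) (J : Finset α) : ℝ :=
  ∑ L ∈ Finset.univ.filter (fun L => J ⊆ L),
    (b : ℝ) ^ (P.filter (fun e => e ⊆ L)).card / (N : ℝ) ^ L.card

noncomputable def qq (φ : α × Fin N ↪ Fin n) (F : Finset (α → Fin N)) (e J : Finset α)
    (x y : Finset (Fin n)) : ℝ :=
  ((F ×ˢ F).filter (fun p => (∀ a ∈ J, p.1 a = p.2 a) ∧ edg φ e p.1 = x ∧ edg φ e p.2 = y)).card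

theorem sum_qq (φ : α × Fin N ↪ Fin n) (F : Finset (α → Fin N)) (e J : Finset α)
    (T1 T2 : Finset (Finset (Fin n))) :
    ∑ x ∈ T1, ∑ y ∈ T2, qq φ F e J x y = 
      ((F ×ˢ F).filter (fun p => (∀ a ∈ J, p.1 a = p.2 a) ∧
        edg φ e p.1 ∈ T1 ∧ edg φ e p.2 ∈ T2)).card := by
  rw [Finset.card_eq_sum_card_fiberwise (f := fun p => (edg φ e p.1, edg φ e p.2))
    (t := T1 ×ˢ T2)]
  · rw [Finset.sum_product]
    push_cast
    refine Finset.sum_congr rfl fun x hx => Finset.sum_congr rfl fun y hy => ?_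
    unfold qq
    congr 2
    ext p
    simp only [Finset.mem_filter, Prod.mk.injEq]
    constructor
    · rintro ⟨h1, h2, rfl, rfl⟩; exact ⟨⟨h1, h2, hx, hy⟩, rfl, rfl⟩
    · rintro ⟨⟨h1, h2, _, _⟩, h3, h4⟩; exact ⟨h1, h2, h3, h4⟩
  · intro p hp
    simp only [Finset.coe_filter, Set.mem_ofPred_eq] at hp
    simpa using hp.2.2

theorem qq_symm (φ : α × Fin N ↪ Fin n) (F : Finset (α → Fin N)) (e J : Finset α)
    (x y : Finset (Fin n)) : qq φ F e J x y = qq φ F e J y x := by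
  unfold qq
  norm_cast
  refine Finset.card_bij (fun p _ => (p.2, p.1)) ?_ ?_ ?_
  · intro p hp
    simp only [Finset.mem_filter, Finset.mem_product] at hp ⊢
    exact ⟨⟨hp.1.2, hp.1.1⟩, fun a ha => (hp.2.1 a ha).symm, hp.2.2.2, hp.2.2.1⟩
  · rintro ⟨a, b⟩ _ ⟨c, d⟩ _ h
    simp only [Prod.mk.injEq] at h ⊢
    exact ⟨h.2, h.1⟩
  · intro p hp
    refine ⟨(p.2, p.1), ?_, rfl⟩
    simp only [Finset.mem_filter, Finset.mem_product] at hp ⊢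
    exact ⟨⟨hp.1.2, hp.1.1⟩, fun a ha => (hp.2.1 a ha).symm, hp.2.2.2, hp.2.2.1⟩

theorem qq_nonneg (φ : α × Fin N ↪ Fin n) (F : Finset (α → Fin N)) (e J : Finset α)
    (x y : Finset (Fin n)) : 0 ≤ qq φ F e J x y := by
  unfold qq; positivity

theorem qq_diag (φ : α × Fin N ↪ Fin n) (F : Finset (α → Fin N)) (e J : Finset α)
    (x : Finset (Fin n)) : qq φ F e J x x ≤ qq φ F e (J ∪ e) x x := by
  unfold qq
  norm_cast
  refine Finset.card_le_card fun p hp => ?_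
  simp only [Finset.mem_filter, Finset.mem_union] at hp ⊢
  refine ⟨hp.1, ?_, hp.2.2⟩
  rintro a (ha | ha)
  · exact hp.2.1 a ha
  · exact (edg_iff φ).1 (hp.2.2.1.trans hp.2.2.2.symm) a ha

noncomputable def DD (φ : α × Fin N ↪ Fin n) (F : Finset (α → Fin N)) (e : Finset α)
    (x : Finset (Fin n)) : ℝ := (F.filter (fun f => edg φ e f = x)).card

theorem sum_DD (φ : α × Fin N ↪ Fin n) (F : Finset (α → Fin N)) (e : Finset α)
    (T : Finset (Finset (Fin n))) :
    ∑ x ∈ T, DD φ F e x = (F.filter (fun f => edg φ e f ∈ T)).card := by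
  rw [Finset.card_eq_sum_card_fiberwise (f := fun f => edg φ e f) (t := T)]
  · push_cast
    refine Finset.sum_congr rfl fun x hx => ?_
    unfold DD
    congr 2
    ext p
    simp only [Finset.mem_filter]
    constructor
    · rintro ⟨h1, rfl⟩; exact ⟨⟨h1, hx⟩, rfl⟩
    · rintro ⟨⟨h1, _⟩, h3⟩; exact ⟨h1, h3⟩
  · intro p hp
    simp only [Finset.coe_filter, Set.mem_ofPred_eq] at hp
    exact hp.2

theorem DD_sq (φ : α × Fin N ↪ Fin n) (F : Finset (α → Fin N)) (e : Finset α)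
    (x : Finset (Fin n)) : DD φ F e x ^ 2 ≤ qq φ F e e x x := by
  unfold DD qq
  norm_cast
  rw [sq, ← Finset.card_product]
  refine Finset.card_le_card fun p hp => ?_
  simp only [Finset.mem_filter, Finset.mem_product] at hp ⊢
  exact ⟨⟨hp.1.1, hp.2.1⟩, (edg_iff φ).1 (hp.1.2.trans hp.2.2.symm), hp.1.2, hp.2.2⟩

def InvC (φ : α × Fin N ↪ Fin n) (b : ℕ) (P : Finset (Finset α)) (a K : ℝ)
    (O S : Finset (Finset (Fin n))) : Prop :=
  (∀ x ∈ O ∪ S, ∃ e ∈ P, ∃ f, x = edg φ e f) ∧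
  a * N ^ (Fintype.card α) / b ^ P.card ≤ (cop φ P S).card ∧
  ∀ J, MM (cop φ P S) J ≤ K * (N ^ (2 * Fintype.card α) / b ^ (2 * P.card)) * beta b N P J

theorem beta_nonneg (b : ℕ) (P : Finset (Finset α)) (J : Finset α) : 0 ≤ beta b N P J := by
  unfold beta
  exact Finset.sum_nonneg fun _ _ => by positivity

theorem beta_mono_P (b : ℕ) (hb : 1 ≤ b) {P P' : Finset (Finset α)} (h : P ⊆ P') (J : Finset α) :
    beta b N P J ≤ beta b N P' J := by
  unfold beta
  refine Finset.sum_le_sum fun L _ => ?_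
  have : (1 : ℝ) ≤ b := by exact_mod_cast hb
  gcongr

theorem beta_anti (b : ℕ) (P : Finset (Finset α)) {J J' : Finset α} (h : J ⊆ J') :
    beta b N P J' ≤ beta b N P J := by
  unfold beta
  refine Finset.sum_le_sum_of_subset_of_nonneg ?_ fun _ _ _ => by positivity
  intro L hL
  simp only [Finset.mem_filter, Finset.mem_univ, true_and] at hL ⊢
  exact h.trans hL

theorem beta_insert (b : ℕ) (P : Finset (Finset α)) (e J : Finset α) (he : e ∉ P) (h : e ⊆ J) :
    beta b N (insert e P) J = b * beta b N P J := by
  unfold beta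
  rw [Finset.mul_sum]
  refine Finset.sum_congr rfl fun L hL => ?_
  have hL' : J ⊆ L := (Finset.mem_filter.1 hL).2
  rw [Finset.filter_insert, if_pos (h.trans hL'), Finset.card_insert_of_notMem (by simp [he])]
  rw [pow_succ]; ring

theorem beta_small (b : ℕ) (hb : 1 ≤ b) (hN : 1 ≤ N) (P : Finset (Finset α)) (e : Finset α)
    (he : e ∉ P) (c' : ℝ)
    (hc : ∀ L : Finset α, e ⊆ L →
      (b : ℝ) ^ ((insert e P).filter (fun e => e ⊆ L)).card ≤ c' * N ^ L.card) (hc0 : 0 ≤ c') :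
    b * beta b N P e ≤ 2 ^ Fintype.card α * c' := by
  rw [← beta_insert b P e e he le_rfl]
  unfold beta
  have hN0 : (0 : ℝ) < N := by exact_mod_cast hN
  calc _ ≤ ∑ L ∈ Finset.univ.filter (fun L => e ⊆ L), c' := by
        refine Finset.sum_le_sum fun L hL => ?_
        rw [div_le_iff₀ (by positivity)]
        exact hc L (Finset.mem_filter.1 hL).2
    _ ≤ ∑ L : Finset α, c' :=
        Finset.sum_le_sum_of_subset_of_nonneg (Finset.filter_subset _ _) fun _ _ _ => hc0
    _ = _ := by simp

theorem step_lemma (φ : α × Fin N ↪ Fin n) (b k : ℕ) (hb : 1 ≤ b) (hN : 1 ≤ N)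
    (P : Finset (Finset α)) (e : Finset α) (he : e ∉ P) (hek : e.card = k) (a K c' : ℝ)
    (ha : 0 < a) (hK : 0 < K) (hc0 : 0 ≤ c')
    (hc : ∀ L : Finset α, e ⊆ L →
      (b : ℝ) ^ ((insert e P).filter (fun e => e ⊆ L)).card ≤ c' * N ^ L.card)
    (hcK : 64 * K * (2 ^ Fintype.card α * c') ≤ a ^ 2)
    (O S : Finset (Finset (Fin n))) (hI : InvC φ b P a K O S) :
    Wins (Finset.univ.powersetCard k : Finset (Finset (Fin n))) b
      (InvC φ b (insert e P) (a / 4) ((8 * 2 ^ Fintype.card α) ^ 2 * K)) O S := by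
  obtain ⟨hO, hA, hM⟩ := hI
  have hb0 : (0 : ℝ) < b := by exact_mod_cast hb
  have hN0 : (0 : ℝ) < N := by exact_mod_cast hN
  set F := cop φ P S with hF
  set C : ℝ := 8 * 2 ^ Fintype.card α with hC
  have hC1 : 1 ≤ C := by
    have : (1 : ℝ) ≤ 2 ^ Fintype.card α := one_le_pow₀ (by norm_num)
    linarith
  set R : Finset (Finset (Fin n)) := Finset.univ.image (edg φ e) with hR
  have hmemR : ∀ f, edg φ e f ∈ R := fun f => Finset.mem_image_of_mem _ (Finset.mem_univ _)
  have hApos : (0 : ℝ) < F.card := lt_of_lt_of_le (by positivity) hA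
  have hMM : ∀ J, ∑ x ∈ R, ∑ y ∈ R, qq φ F e J x y = MM F J := by
    intro J
    rw [sum_qq]; unfold MM
    simp only [hmemR, and_true]
  have hMpos : ∀ J, 0 < MM F J := by
    intro J
    obtain ⟨f, hf⟩ := Finset.card_pos.1 (by exact_mod_cast hApos : 0 < F.card)
    unfold MM
    have : 0 < ((F ×ˢ F).filter (fun p => ∀ a ∈ J, p.1 a = p.2 a)).card :=
      Finset.card_pos.2 ⟨(f, f), by simp [hf]⟩
    exact_mod_cast this
  have hdisj : ∀ x ∈ O ∪ S, x ∉ R := by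
    intro x hx hxR
    obtain ⟨e', he', f, rfl⟩ := hO x hx
    obtain ⟨f', -, hf'⟩ := Finset.mem_image.1 hxR
    have := edg_eq φ hf'
    exact he (this ▸ he')
  have hst := stage (ι := Finset α) (Finset.univ.powersetCard k : Finset (Finset (Fin n))) R O S b hb
    (by
      intro x hx
      obtain ⟨f', -, rfl⟩ := Finset.mem_image.1 hx
      simp [edg_card, hek])
    (Finset.disjoint_left.2 fun x hx hx' => hdisj x (Finset.mem_union_left _ hx') hx)
    (DD φ F e) (fun x => by unfold DD; positivity) F.card C hApos
    (by rw [sum_DD]; simp only [hmemR, Finset.filter_true])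
    (by linarith) (by simp [hC])
    (by
      rw [le_div_iff₀ (by positivity)]
      have h1 : ∑ x ∈ R, DD φ F e x ^ 2 ≤ MM F e := by
        rw [← hMM]
        refine Finset.sum_le_sum fun x hx => (DD_sq φ F e x).trans ?_
        exact Finset.single_le_sum (f := fun y => qq φ F e e x y)
          (fun _ _ => qq_nonneg _ _ _ _ _ _) hx
      have h2 := hM e
      have h3 := beta_small b hb hN P e he c' hc hc0
      have h4 : (0:ℝ) ≤ a * N ^ (Fintype.card α) / b ^ P.card := by positivity
      have h5 := pow_le_pow_left₀ h4 hA 2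
      have h6 : (0 : ℝ) ≤ N ^ (2 * Fintype.card α) / b ^ (2 * P.card) := by positivity
      have h7 : (a * N ^ (Fintype.card α) / b ^ P.card : ℝ) ^ 2 =
        a ^ 2 * (N ^ (2 * Fintype.card α) / b ^ (2 * P.card)) := by
        rw [div_pow, mul_pow, ← pow_mul, ← pow_mul, mul_comm _ 2, mul_comm _ 2]; ring
      rw [h7] at h5
      refine le_trans ?_ h5
      set Z : ℝ := N ^ (2 * Fintype.card α) / b ^ (2 * P.card)
      calc (∑ x ∈ R, DD φ F e x ^ 2) * (64 * b) ≤ (K * Z * beta b N P e) * (64 * b) := by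
            gcongr; exact h1.trans h2
        _ = 64 * K * (b * beta b N P e) * Z := by ring
        _ ≤ 64 * K * (2 ^ Fintype.card α * c') * Z := by gcongr
        _ ≤ a ^ 2 * Z := by gcongr)
    (qq φ F e) (fun J => qq_nonneg φ F e J) (fun J => qq_symm φ F e J) (MM F) hMpos
    (fun J => (hMM J).le)
  refine hst.bind fun O' S' hE => Wins.fin _ _ ?_
  obtain ⟨hO', T, hTR, rfl, hT1, hT2, hT3⟩ := hE
  have hF' : cop φ (insert e P) (S ∪ T) = F.filter (fun f => edg φ e f ∈ T) := by
    ext f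
    simp only [hF, cop, Finset.mem_filter, Finset.mem_univ, true_and, Finset.mem_insert,
      forall_eq_or_imp, Finset.mem_union]
    constructor
    · rintro ⟨h1, h2⟩
      refine ⟨fun e' he' => (h2 e' he').resolve_right fun h => ?_, h1.resolve_left fun h => ?_⟩
      · obtain ⟨f', -, hf'⟩ := Finset.mem_image.1 (hTR h)
        exact he (edg_eq φ hf' ▸ he')
      · exact hdisj _ (Finset.mem_union_right _ h) (hmemR f)
    · rintro ⟨h1, h2⟩
      exact ⟨Or.inr h2, fun e' he' => Or.inl (h1 e' he')⟩
  refine ⟨?_, ?_, ?_⟩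
  · intro x hx
    have : x ∈ O ∪ S ∨ x ∈ R := by
      rcases Finset.mem_union.1 hx with h | h
      · rcases Finset.mem_union.1 (hO' h) with h | h
        · exact Or.inl (Finset.mem_union_left _ h)
        · exact Or.inr h
      · rcases Finset.mem_union.1 h with h | h
        · exact Or.inl (Finset.mem_union_right _ h)
        · exact Or.inr (hTR h)
    rcases this with h | h
    · obtain ⟨e', he', f, hf⟩ := hO x h
      exact ⟨e', Finset.mem_insert_of_mem he', f, hf⟩
    · obtain ⟨f, -, hf⟩ := Finset.mem_image.1 h
      exact ⟨e, Finset.mem_insert_self _ _, f, hf.symm⟩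
  · rw [hF', ← sum_DD, Finset.card_insert_of_notMem he]
    refine le_trans ?_ hT1
    calc a / 4 * N ^ Fintype.card α / (b : ℝ) ^ (P.card + 1)
        = (a * N ^ (Fintype.card α) / b ^ P.card) / (4 * b) := by
          rw [pow_succ]; field_simp
      _ ≤ _ := by gcongr
  · intro J
    have hMJ : MM (cop φ (insert e P) (S ∪ T)) J =
        offd (qq φ F e J) T + ∑ x ∈ T, qq φ F e J x x := by
      have h1 : MM (cop φ (insert e P) (S ∪ T)) J = ∑ x ∈ T, ∑ y ∈ T, qq φ F e J x y := by
        rw [sum_qq, hF']; unfold MM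
        congr 2
        ext p
        simp only [Finset.mem_filter, Finset.mem_product]
        tauto
      rw [h1]; unfold offd
      rw [← Finset.sum_add_distrib]
      refine Finset.sum_congr rfl fun x hx => ?_
      have : qq φ F e J x x = ∑ y ∈ T, if x = y then qq φ F e J x y else 0 := by
        rw [Finset.sum_ite_eq, if_pos hx]
      rw [this, ← Finset.sum_add_distrib]
      refine Finset.sum_congr rfl fun y hy => ?_
      split_ifs <;> simp
    rw [hMJ]
    have hdiag : ∑ x ∈ T, qq φ F e J x x ≤ ∑ x ∈ T, ∑ y ∈ R, qq φ F e (J ∪ e) x y := by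
      refine Finset.sum_le_sum fun x hx => (qq_diag φ F e J x).trans ?_
      exact Finset.single_le_sum (f := fun y => qq φ F e (J ∪ e) x y)
        (fun _ _ => qq_nonneg _ _ _ _ _ _) (hTR hx)
    have hd2 := hT2 (J ∪ e)
    have ho2 := hT3 J
    have b1 : beta b N P J ≤ beta b N (insert e P) J := beta_mono_P b hb (Finset.subset_insert _ _) J
    have b2 : b * beta b N P (J ∪ e) ≤ beta b N (insert e P) J := by
      rw [← beta_insert b P e _ he Finset.subset_union_right]
      exact beta_anti b _ Finset.subset_union_left
    have m1 := hM J
    have m2 := hM (J ∪ e)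
    rw [Finset.card_insert_of_notMem he]
    set Y := beta b N (insert e P) J
    set Z : ℝ := N ^ (2 * Fintype.card α) / b ^ (2 * P.card) with hZ
    have hZ0 : 0 ≤ Z := by positivity
    have hZ' : (N : ℝ) ^ (2 * Fintype.card α) / b ^ (2 * (P.card + 1)) = Z / b ^ 2 := by
      rw [hZ, mul_add, pow_add, div_div]
    have hY0 : 0 ≤ Y := beta_nonneg b _ J
    rw [hZ']
    have r1 : offd (qq φ F e J) T ≤ C ^ 2 * (K * Z * Y) / (2 * b ^ 2) := by
      rw [le_div_iff₀ (by positivity)]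
      refine ho2.trans ?_
      gcongr
      exact m1.trans (by gcongr)
    have r2 : ∑ x ∈ T, qq φ F e J x x ≤ C ^ 2 * (K * Z * Y) / (2 * b ^ 2) := by
      rw [le_div_iff₀ (by positivity)]
      calc (∑ x ∈ T, qq φ F e J x x) * (2 * (b:ℝ) ^ 2)
          ≤ (∑ x ∈ T, ∑ y ∈ R, qq φ F e (J ∪ e) x y) * (2 * (b:ℝ) ^ 2) := by gcongr
        _ = ((∑ x ∈ T, ∑ y ∈ R, qq φ F e (J ∪ e) x y) * (2 * b)) * b := by ring
        _ ≤ (C * (K * Z * beta b N P (J ∪ e))) * b := by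
            refine mul_le_mul_of_nonneg_right (hd2.trans ?_) hb0.le
            gcongr
        _ = C * (K * Z * (b * beta b N P (J ∪ e))) := by ring
        _ ≤ C * (K * Z * Y) := by gcongr
        _ ≤ C ^ 2 * (K * Z * Y) := by
            have : C ≤ C ^ 2 := by nlinarith
            gcongr
    calc _ ≤ C ^ 2 * (K * Z * Y) / (2 * b ^ 2) + C ^ 2 * (K * Z * Y) / (2 * b ^ 2) :=
          add_le_add r1 r2
      _ = _ := by field_simp; ring

theorem MM_univ (hN : 1 ≤ N) (J : Finset α) :
    MM (Finset.univ : Finset (α → Fin N)) J ≤ N ^ (2 * Fintype.card α) / N ^ J.card := by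
  have hN0 : (0 : ℝ) < N := by exact_mod_cast hN
  rw [le_div_iff₀ (by positivity)]
  unfold MM
  have : ((Finset.univ ×ˢ Finset.univ : Finset ((α → Fin N) × (α → Fin N))).filter
      (fun p => ∀ a ∈ J, p.1 a = p.2 a) ×ˢ (Finset.univ : Finset (J → Fin N))).card ≤
      (Finset.univ : Finset ((α → Fin N) × (α → Fin N))).card := by
    refine Finset.card_le_card_of_injOn
      (fun t => (t.1.1, fun a => if h : a ∈ J then t.2 ⟨a, h⟩ else t.1.2 a)) (by simp) ?_
    rintro ⟨⟨f, f'⟩, g⟩ h1 ⟨⟨u, u'⟩, w⟩ h2 h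
    simp only [Finset.coe_product, Set.mem_prod, Finset.coe_filter, Finset.mem_product,
      Finset.mem_univ, true_and, Set.mem_ofPred_eq, Finset.coe_univ, Set.mem_univ, and_true] at h1 h2
    simp only [Prod.mk.injEq] at h ⊢
    obtain ⟨rfl, h⟩ := h
    refine ⟨⟨rfl, ?_⟩, ?_⟩
    · funext a
      by_cases ha : a ∈ J
      · rw [← h1 a ha, ← h2 a ha]
      · have := congrFun h a
        simpa [ha] using this
    · funext ⟨a, ha⟩
      have := congrFun h a
      simpa [ha] using this
  rw [Finset.card_product] at this
  simp only [Finset.card_univ, Fintype.card_prod, Fintype.card_fun, Fintype.card_fin,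
    Fintype.card_coe] at this
  rw [two_mul, pow_add]
  exact_mod_cast this

theorem all_edges (φ : α × Fin N ↪ Fin n) (b k : ℕ) (hb : 1 ≤ b) (hN : 1 ≤ N)
    (E : Finset (Finset α)) (hE : ∀ e ∈ E, e.card = k) (c' : ℝ) (hc0 : 0 ≤ c')
    (hc : ∀ e ∈ E, ∀ L : Finset α, e ⊆ L →
      (b : ℝ) ^ (E.filter (fun e => e ⊆ L)).card ≤ c' * N ^ L.card)
    (hcK : 64 * ((8 * 2 ^ Fintype.card α) ^ 2) ^ E.card * (2 ^ Fintype.card α * c') ≤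
      ((1 / 4 : ℝ) ^ E.card) ^ 2) (P : Finset (Finset α)) (hP : P ⊆ E) :
    Wins (Finset.univ.powersetCard k : Finset (Finset (Fin n))) b
      (InvC φ b P ((1 / 4) ^ P.card) (((8 * 2 ^ Fintype.card α) ^ 2) ^ P.card)) ∅ ∅ := by
  have hb1 : (1 : ℝ) ≤ b := by exact_mod_cast hb
  induction P using Finset.induction_on with
  | empty =>
    refine Wins.fin _ _ ⟨by simp, by simp [cop], fun J => ?_⟩
    have h1 : cop φ ∅ ∅ = Finset.univ := by simp [cop]
    rw [h1]
    refine (MM_univ hN J).trans ?_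
    simp only [Finset.card_empty, pow_zero, one_mul, mul_zero, div_one]
    rw [div_eq_mul_one_div]
    gcongr
    unfold beta
    have := Finset.single_le_sum (f := fun L : Finset α =>
      (b : ℝ) ^ ((∅ : Finset (Finset α)).filter (fun e => e ⊆ L)).card / (N : ℝ) ^ L.card)
      (s := Finset.univ.filter (fun L => J ⊆ L)) (fun _ _ => by positivity)
      (Finset.mem_filter.2 ⟨Finset.mem_univ J, le_rfl⟩)
    simpa using this
  | insert e P he ih =>
    have hPE : P ⊆ E := (Finset.subset_insert _ _).trans hP
    have heE : e ∈ E := hP (Finset.mem_insert_self _ _)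
    refine (ih hPE).bind fun O S hI => ?_
    have hcd := Finset.card_le_card hPE
    have hC1 : (1 : ℝ) ≤ (8 * 2 ^ Fintype.card α) ^ 2 := by
      have : (1 : ℝ) ≤ 2 ^ Fintype.card α := one_le_pow₀ (by norm_num)
      exact one_le_pow₀ (by linarith)
    have := step_lemma φ b k hb hN P e he (hE e heE) ((1 / 4) ^ P.card)
      (((8 * 2 ^ Fintype.card α) ^ 2) ^ P.card) c' (by positivity) (by positivity) hc0
      (fun L hL => (pow_le_pow_right₀ hb1
        (Finset.card_le_card (Finset.filter_subset_filter _ hP))).trans (hc e heE L hL))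
      (by
        refine le_trans ?_ (hcK.trans ?_)
        · gcongr
        · gcongr ?_ ^ 2
          exact pow_le_pow_of_le_one (by norm_num) (by norm_num) hcd) O S hI
    rw [Finset.card_insert_of_notMem he, pow_succ, pow_succ, mul_comm (((8 * _) ^ 2) ^ _)]
    convert this using 2
    ring

theorem cop_count (φ : α × Fin N ↪ Fin n) (E : Finset (Finset α)) (S : Finset (Finset (Fin n))) :
    (cop φ E S).card ≤ hCopyCount E S := by
  unfold hCopyCount
  let g : (α → Fin N) → (α ↪ Fin n) := fun f =>
    ⟨fun a => φ (a, f a), fun a b h => congrArg Prod.fst (φ.injective h)⟩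
  have hg : ∀ f (e : Finset α), e.map (g f) = edg φ e f := fun f e => by
    rw [Finset.map_eq_image]; rfl
  rw [← Set.ncard_coe_finset]
  refine Set.ncard_le_ncard_of_injOn
    (fun f => (Finset.univ.map (g f), E.image (fun e => e.map (g f)))) ?_ ?_ (Set.toFinite _)
  · intro f hf
    refine ⟨g f, rfl, rfl, ?_⟩
    simp only [cop, Finset.coe_filter, Set.mem_ofPred_eq, Finset.mem_univ, true_and] at hf
    intro x hx
    obtain ⟨e, he, rfl⟩ := Finset.mem_image.1 hx
    simp only [hg]
    exact hf e he
  · intro f _ f' _ h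
    have := congrArg Prod.fst h
    simp only [hg] at this
    funext a
    exact (edg_iff φ).1 this a (Finset.mem_univ a)

theorem dens_le (E : Finset (Finset α)) (L : Finset α) (hL : L.Nonempty) :
    ((E.filter (fun e => e ⊆ L)).card : ℝ) / L.card ≤ hMaxDensity E := by
  unfold hMaxDensity
  refine le_csSup ⟨E.card, ?_⟩ ⟨L, E.filter (fun e => e ⊆ L), Finset.filter_subset _ _, ?_, hL, rfl⟩
  · rintro d ⟨V, E', h1, -, h3, rfl⟩
    have : (1 : ℝ) ≤ V.card := by exact_mod_cast Finset.card_pos.2 h3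
    have h4 : (E'.card : ℝ) ≤ E.card := by exact_mod_cast Finset.card_le_card h1
    exact (div_le_self (by positivity) this).trans h4
  · intro e he; exact (Finset.mem_filter.1 he).2

end hyper

open Filter WCGame in
/-- the analogue of Statement 0 for `k`-uniform hypergraphs, the
board being the set of all `k`-element subsets of an `n`-element vertex set. -/
theorem waiter_client_hypergraphs {α : Type*} [Fintype α] [DecidableEq α]
    (k : ℕ) (hk : 2 ≤ k) (E : Finset (Finset α))
    (hunif : ∀ e ∈ E, e.card = k) (hE : E.Nonempty) :
    ∃ c γ : ℝ, 0 < c ∧ 0 < γ ∧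
      ∀ᶠ n : ℕ in atTop, ∀ b : ℕ, 1 ≤ b →
        (b : ℝ) ≤ c * (n : ℝ) ^ (1 / hMaxDensity E) →
        WaiterCanEnsure (Finset.univ.powersetCard k : Finset (Finset (Fin n))) b
          (fun S =>
            γ * (n : ℝ) ^ (Fintype.card α) / (b : ℝ) ^ (E.card) ≤
              (hCopyCount E S : ℝ)) := by
  classical
  obtain ⟨e0, he0⟩ := hE
  have hv : 0 < Fintype.card α := by
    have h1 := hunif e0 he0
    have h2 := Finset.card_le_univ e0
    omega
  set v := Fintype.card α with hvdef
  have hv1 : (1 : ℝ) ≤ 2 * v := by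
    have : (1 : ℝ) ≤ v := by exact_mod_cast hv
    linarith
  have hne : ∀ e ∈ E, e.Nonempty := fun e he => by
    rw [← Finset.card_pos, hunif e he]; omega
  set m := hMaxDensity E with hm
  have hm0 : 0 < m := by
    refine lt_of_lt_of_le ?_ (dens_le E e0 (hne e0 he0))
    have h1 : 0 < e0.card := Finset.card_pos.2 (hne e0 he0)
    have h2 : 0 < (E.filter (fun e => e ⊆ e0)).card :=
      Finset.card_pos.2 ⟨e0, Finset.mem_filter.2 ⟨he0, le_rfl⟩⟩
    positivity
  set K : ℝ := ((8 * 2 ^ v) ^ 2) ^ E.card with hK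
  have hK0 : 0 < K := by positivity
  set c' : ℝ := ((1 / 4 : ℝ) ^ E.card) ^ 2 / (64 * K * 2 ^ v) with hc'
  have hc'0 : 0 < c' := by positivity
  set d : ℝ := c' / (2 * v) ^ v with hd
  have hd0 : 0 < d := by positivity
  refine ⟨min 1 (d ^ (1 / m)), (1 / 4) ^ E.card / (2 * v) ^ v, by positivity, by positivity, ?_⟩
  filter_upwards [Filter.eventually_ge_atTop v] with n hn b hb hbn
  set c : ℝ := min 1 (d ^ (1 / m)) with hc
  have hc0 : 0 < c := by positivity
  set N := n / v with hNdef
  have hN : 1 ≤ N := (Nat.one_le_div_iff hv).2 hn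
  have hvN : v * N ≤ n := Nat.mul_div_le n v
  have hnN : n ≤ 2 * v * N := by
    have h1 : n < v * (N + 1) := by
      have := Nat.lt_mul_div_succ n hv
      simpa using this
    nlinarith
  have hnN' : (n : ℝ) ≤ 2 * v * N := by exact_mod_cast hnN
  have hb1 : (1 : ℝ) ≤ b := by exact_mod_cast hb
  obtain ⟨φ⟩ : Nonempty (α × Fin N ↪ Fin n) :=
    Function.Embedding.nonempty_of_card_le (by simpa using hvN)
  have hW := all_edges φ b k hb hN E hunif c' hc'0.le (by
      intro e he L hL
      have hLne : L.Nonempty := (hne e he).mono hL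
      have hL0 : (1 : ℝ) ≤ L.card := by exact_mod_cast Finset.card_pos.2 hLne
      have hLv : L.card ≤ v := Finset.card_le_univ L
      have h1 : ((E.filter (fun e => e ⊆ L)).card : ℝ) ≤ m * L.card := by
        rw [← div_le_iff₀ (by linarith)]; exact dens_le E L hLne
      have hn0 : (0 : ℝ) ≤ n := by positivity
      calc (b : ℝ) ^ (E.filter (fun e => e ⊆ L)).card
          = (b : ℝ) ^ ((E.filter (fun e => e ⊆ L)).card : ℝ) := (Real.rpow_natCast _ _).symm
        _ ≤ (b : ℝ) ^ (m * L.card) := Real.rpow_le_rpow_of_exponent_le hb1 h1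
        _ ≤ (c * (n : ℝ) ^ (1 / m)) ^ (m * L.card) :=
            Real.rpow_le_rpow (by positivity) hbn (by positivity)
        _ = c ^ (m * L.card) * (n : ℝ) ^ L.card := by
            rw [Real.mul_rpow hc0.le (by positivity), ← Real.rpow_mul hn0, ← mul_assoc,
              one_div_mul_cancel hm0.ne', one_mul, Real.rpow_natCast]
        _ ≤ d * ((2 * v) ^ v * N ^ L.card) := by
            gcongr
            · calc c ^ (m * L.card) ≤ c ^ m :=
                    Real.rpow_le_rpow_of_exponent_ge hc0 (min_le_left _ _) (by nlinarith)
                _ ≤ (d ^ (1 / m)) ^ m :=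
                    Real.rpow_le_rpow hc0.le (min_le_right _ _) hm0.le
                _ = d := by
                    rw [← Real.rpow_mul hd0.le, one_div_mul_cancel hm0.ne', Real.rpow_one]
            · calc (n : ℝ) ^ L.card ≤ (2 * v * N) ^ L.card := by gcongr
                _ = (2 * v) ^ L.card * N ^ L.card := by rw [mul_pow]
                _ ≤ _ := by gcongr
        _ = c' * N ^ L.card := by
            rw [hd]; field_simp)
    (by
      have h : 64 * K * (2 ^ v * c') = ((1 / 4 : ℝ) ^ E.card) ^ 2 := by
        rw [mul_comm (2 ^ v : ℝ) c', mul_comm, mul_assoc, mul_comm (2 ^ v : ℝ), hc']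
        exact div_mul_cancel₀ _ (by positivity)
      exact h.le) E le_rfl
  refine hW.ensure hb _ ?_
  rintro O S ⟨-, h2, -⟩
  have h3 : ((cop φ E S).card : ℝ) ≤ hCopyCount E S := by exact_mod_cast cop_count φ E S
  refine le_trans ?_ (h2.trans h3)
  gcongr ?_ / _
  rw [div_mul_eq_mul_div, div_le_iff₀ (by positivity), mul_assoc]
  gcongr
  calc (n : ℝ) ^ v ≤ (2 * v * N) ^ v := by gcongr
    _ = N ^ v * (2 * v) ^ v := by rw [mul_pow]; ring
end
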